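/- arXiv:0706.0946 — 3 statements merged into one kernel-verified Lean document; each statement's English description precedes it below -/
import Mathlib

section
/- There exist a real-analytic curve γ : ℝ → ℝ³ with γ(t+2π) = γ(t) and γ'(t) ≠ 0 for all t, a real-analytic vector field ξ : ℝ → ℝ³ with ξ(t+2π) = −ξ(t), ‖ξ(t)‖ = 1, ξ(t)·γ'(t) = 0 and ξ'(t) × γ'(t) = 0 for all t, and a real ε > 0 such that for all t,s ∈ ℝ and u,v ∈ (−ε,ε), if γ(t) + u·ξ(t) = γ(s) + v·ξ(s) then there is an integer k with s = t + 2πk and v = (−1)^k·u. (Existence of an embedded real-analytic principal Möbius developable: the conditions ξ·γ' = 0 and ξ' ∥ γ' make the flat ruled strip F(t,u) = γ(t) + u·ξ(t) principal, the anti-periodicity of ξ makes it a Möbius strip, and the last condition makes it embedded.) -/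
open Real

noncomputable abbrev E3 := EuclideanSpace ℝ (Fin 3)

/-- The cross product of vectors in Euclidean 3-space. -/
noncomputable def cross3 (u v : E3) : E3 :=
  (WithLp.equiv 2 (Fin 3 → ℝ)).symm
    ![u 1 * v 2 - u 2 * v 1, u 2 * v 0 - u 0 * v 2, u 0 * v 1 - u 1 * v 0]

/-- The dot product of vectors in Euclidean 3-space. -/
noncomputable def dot3 (u v : E3) : ℝ := u 0 * v 0 + u 1 * v 1 + u 2 * v 2

/-- The determinant of the 3×3 matrix with columns `u`, `v`, `w`. -/
noncomputable def det3 (u v w : E3) : ℝ := dot3 u (cross3 v w)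

open Set

/-- Over a compact family of parameter pairs on which a regular curve `γ` is injective, a thin
enough ruled strip with unit directors normal to `γ` is injective. -/
theorem exists_strip_injective_of_isCompact {E : Type*} [NormedAddCommGroup E]
    [InnerProductSpace ℝ E] {γ ξ : ℝ → E} (hγ : ContDiff ℝ 1 γ) (hξ : ContDiff ℝ 1 ξ)
    (hreg : ∀ t, deriv γ t ≠ 0) (hunit : ∀ t, ‖ξ t‖ = 1)
    (horth : ∀ t, inner ℝ (deriv γ t) (ξ t) = 0) {a b : ℝ} {A : Set (ℝ × ℝ)} (hA : IsCompact A)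
    (hAK : A ⊆ Icc a b ×ˢ Icc a b) (hinj : ∀ p ∈ A, γ p.1 = γ p.2 → p.1 = p.2) :
    ∃ ε > 0, ∀ t s u v : ℝ, (t, s) ∈ A → |u| < ε → |v| < ε →
      γ t + u • ξ t = γ s + v • ξ s → t = s ∧ u = v := by
  have hγ' : Continuous (deriv γ) := hγ.continuous_deriv le_rfl
  have hξ' : Continuous (deriv ξ) := hξ.continuous_deriv le_rfl
  obtain ⟨m, hm, hm'⟩ := (isCompact_Icc (a := a) (b := b)).exists_forall_le'
    hγ'.norm.continuousOn fun t _ ↦ norm_pos_iff.2 (hreg t)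
  obtain ⟨L, hL⟩ := (isCompact_Icc (a := a) (b := b)).exists_bound_of_continuousOn hξ'.continuousOn
  obtain ⟨δ, hδ, hδ'⟩ := Metric.uniformContinuousOn_iff.1
    ((isCompact_Icc (a := a) (b := b)).uniformContinuousOn_of_continuous hγ'.continuousOn)
    (m / 2) (by positivity)
  have hfar : IsCompact (A ∩ {p | δ ≤ |p.2 - p.1|}) :=
    hA.inter_right (isClosed_le continuous_const (by fun_prop))
  obtain ⟨d, hd, hd'⟩ := hfar.exists_forall_le' (a := 0) (f := fun p ↦ ‖γ p.1 - γ p.2‖)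
    (by have := hγ.continuous; fun_prop) (by
      rintro p ⟨hp, hp'⟩
      refine norm_pos_iff.2 (sub_ne_zero.2 fun h ↦ ?_)
      have := hinj p hp h
      simp only [mem_ofPred_eq, this, sub_self, abs_zero] at hp'
      exact hδ.not_ge hp')
  refine ⟨min (d / 2) (m / (4 * (|L| + 1))), by positivity, fun t s u v hts hu hv h ↦ ?_⟩
  obtain ⟨hu, -⟩ := lt_min_iff.1 hu
  obtain ⟨hv, hvL⟩ := lt_min_iff.1 hv
  obtain ⟨ht, hs⟩ := hAK hts
  have hts' : t = s := by
    by_contra hne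
    have hpos : 0 < |s - t| := abs_pos.2 (sub_ne_zero.2 (Ne.symm hne))
    have hsub : γ s - γ t = u • ξ t - v • ξ s := by
      rw [sub_eq_sub_iff_add_eq_add, ← h, add_comm]
    rcases le_or_gt δ |s - t| with hst | hst
    · have h₁ := hd' (t, s) ⟨hts, hst⟩
      have h₂ : ‖u • ξ t - v • ξ s‖ ≤ |u| + |v| := by
        simpa [norm_smul, hunit] using norm_sub_le (u • ξ t) (v • ξ s)
      rw [norm_sub_rev, hsub] at h₁
      linarith
    · have hseg : uIcc t s ⊆ Icc a b := uIcc_subset_Icc ht hs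
      have hdist : ∀ x ∈ uIcc t s, dist x t < δ := fun x hx ↦
        (abs_sub_left_of_mem_uIcc hx).trans_lt hst
      have hξL : ‖ξ s - ξ t‖ ≤ L * ‖s - t‖ :=
        (convex_uIcc t s).norm_image_sub_le_of_norm_deriv_le
          (fun x _ ↦ hξ.differentiable one_ne_zero x) (fun x hx ↦ hL x (hseg hx))
          left_mem_uIcc right_mem_uIcc
      have hγm : ‖(γ s - s • deriv γ t) - (γ t - t • deriv γ t)‖ ≤ m / 2 * ‖s - t‖ :=
        (convex_uIcc t s).norm_image_sub_le_of_norm_hasDerivWithin_le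
          (f := fun x ↦ γ x - x • deriv γ t) (f' := fun x ↦ deriv γ x - (1 : ℝ) • deriv γ t)
          (fun x _ ↦ ((hγ.differentiable one_ne_zero x).hasDerivAt.sub
            ((hasDerivAt_id x).smul_const _)).hasDerivWithinAt)
          (fun x hx ↦ by
            rw [one_smul, ← dist_eq_norm]
            exact (hδ' x (hseg hx) t ht (hdist x hx)).le)
          left_mem_uIcc right_mem_uIcc
      rw [Real.norm_eq_abs] at hξL hγm
      have hvξ : ‖v • (ξ s - ξ t)‖ ≤ m / 4 * |s - t| := by
        rw [norm_smul, Real.norm_eq_abs]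
        have hvL' : |v| * (|L| + 1) ≤ m / 4 := by
          rw [lt_div_iff₀ (by positivity)] at hvL
          linarith
        calc |v| * ‖ξ s - ξ t‖ ≤ |v| * ((|L| + 1) * |s - t|) := by
              gcongr
              refine hξL.trans ?_
              gcongr
              linarith [le_abs_self L]
          _ = |v| * (|L| + 1) * |s - t| := by ring
          _ ≤ _ := by gcongr
      have hinner : (s - t) * ‖deriv γ t‖ ^ 2 = inner ℝ (deriv γ t)
          (-((γ s - s • deriv γ t) - (γ t - t • deriv γ t)) - v • (ξ s - ξ t)) := by
        have hvec : -((γ s - s • deriv γ t) - (γ t - t • deriv γ t)) - v • (ξ s - ξ t) =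
            (s - t) • deriv γ t - (u - v) • ξ t := by
          have : γ s = γ t + u • ξ t - v • ξ s := by rw [h, add_sub_cancel_right]
          rw [this]
          module
        rw [hvec, inner_sub_right, inner_smul_right, inner_smul_right, horth,
          real_inner_self_eq_norm_sq]
        ring
      have hbound := abs_real_inner_le_norm (deriv γ t)
          (-((γ s - s • deriv γ t) - (γ t - t • deriv γ t)) - v • (ξ s - ξ t))
      rw [← hinner, abs_mul, abs_of_nonneg (sq_nonneg ‖deriv γ t‖)] at hbound
      have hnorm : ‖-((γ s - s • deriv γ t) - (γ t - t • deriv γ t)) - v • (ξ s - ξ t)‖ ≤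
          3 * m / 4 * |s - t| := by
        refine (norm_sub_le _ _).trans ?_
        rw [norm_neg]
        linarith
      have hmt := hm' t ht
      have hmpos : 0 < ‖deriv γ t‖ := hm.trans_le hmt
      have h₁ : ‖deriv γ t‖ * (|s - t| * ‖deriv γ t‖) ≤ ‖deriv γ t‖ * (3 * m / 4 * |s - t|) := by
        calc _ = |s - t| * ‖deriv γ t‖ ^ 2 := by ring
          _ ≤ _ := hbound.trans (by gcongr)
      have h₂ := le_of_mul_le_mul_left h₁ hmpos
      have h₃ : |s - t| * m ≤ |s - t| * ‖deriv γ t‖ := by gcongr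
      nlinarith
  subst hts'
  refine ⟨rfl, sub_eq_zero.1 ?_⟩
  have : (u - v) • ξ t = 0 := by
    rw [sub_smul, sub_eq_zero]
    exact add_left_cancel h
  refine (smul_eq_zero.1 this).resolve_right fun h0 ↦ ?_
  simpa [h0] using hunit t

/-- An antiperiodic vector-valued function picks up the sign `(-1) ^ k` over `k` antiperiods. -/
theorem Function.Antiperiodic.add_mul_int_eq_zpow_smul {E : Type*} [AddCommGroup E] [Module ℝ E]
    {f : ℝ → E} {c : ℝ} (hf : Function.Antiperiodic f c) (x : ℝ) (k : ℤ) :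
    f (x + c * k) = (-1 : ℝ) ^ k • f x := by
  have h := hf.add_zsmul_eq (x := x) k
  rw [zsmul_eq_mul, mul_comm] at h
  rw [h]
  rcases Int.even_or_odd k with hk | hk
  · simp [Int.negOnePow_even k hk, hk.neg_one_zpow]
  · simp [Int.negOnePow_odd k hk, hk.neg_one_zpow]

/-- A ruled Möbius strip with unit normal directors over a regular simple closed curve is embedded
near that curve. -/
theorem exists_moebius_strip_embedded {E : Type*} [NormedAddCommGroup E]
    [InnerProductSpace ℝ E] {γ ξ : ℝ → E} (hγ : ContDiff ℝ 1 γ) (hξ : ContDiff ℝ 1 ξ)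
    (hγper : Function.Periodic γ (2 * π)) (hξper : Function.Antiperiodic ξ (2 * π))
    (hreg : ∀ t, deriv γ t ≠ 0) (hunit : ∀ t, ‖ξ t‖ = 1)
    (horth : ∀ t, inner ℝ (deriv γ t) (ξ t) = 0)
    (hinj : ∀ t s, γ t = γ s → ∃ k : ℤ, s = t + 2 * π * k) :
    ∃ ε > 0, ∀ t s u v : ℝ, u ∈ Ioo (-ε) ε → v ∈ Ioo (-ε) ε →
      γ t + u • ξ t = γ s + v • ξ s →
      ∃ k : ℤ, s = t + 2 * π * k ∧ v = (-1 : ℝ) ^ k * u := by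
  have hπ := Real.pi_pos
  let A : Set (ℝ × ℝ) := (fun p : ℝ × ℝ ↦ (p.1, p.1 + p.2)) '' (Icc 0 (2 * π) ×ˢ Icc (-π) π)
  have hA : IsCompact A := (isCompact_Icc.prod isCompact_Icc).image (by fun_prop)
  have hAK : A ⊆ Icc (-π) (3 * π) ×ˢ Icc (-π) (3 * π) := by
    rintro _ ⟨p, ⟨⟨h₁, h₂⟩, h₃, h₄⟩, rfl⟩
    exact ⟨⟨by simp only; linarith, by simp only; linarith⟩,
      by simp only; linarith, by simp only; linarith⟩
  have hAinj : ∀ p ∈ A, γ p.1 = γ p.2 → p.1 = p.2 := by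
    rintro _ ⟨⟨t, x⟩, ⟨-, h₃, h₄⟩, rfl⟩ h
    obtain ⟨k, hk⟩ := hinj _ _ h
    simp only at h₃ h₄ hk
    have hx : x = 2 * π * k := by linarith
    have h₁ : (-1 : ℝ) < k := by nlinarith
    have h₂ : (k : ℝ) < 1 := by nlinarith
    have hk0 : k = 0 := by
      have h₁' : -1 < k := by exact_mod_cast h₁
      have h₂' : k < 1 := by exact_mod_cast h₂
      omega
    simp [hx, hk0]
  obtain ⟨ε, hε, H⟩ :=
    exists_strip_injective_of_isCompact hγ hξ hreg hunit horth hA hAK hAinj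
  refine ⟨ε, hε, fun t s u v hu hv h ↦ ?_⟩
  have hγk (x : ℝ) (k : ℤ) : γ (x + 2 * π * k) = γ x := by
    rw [mul_comm]; exact hγper.int_mul k x
  obtain ⟨j, hj, -⟩ := existsUnique_add_zsmul_mem_Ico (a := 2 * π) (by positivity) t 0
  obtain ⟨i, hi, -⟩ := existsUnique_add_zsmul_mem_Ico (a := 2 * π) (by positivity) (s - t) (-π)
  simp only [zsmul_eq_mul, mem_Ico, mul_comm _ (2 * π)] at hj hi
  have hmem : (t + 2 * π * j, s + 2 * π * (i + j : ℤ)) ∈ A := by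
    refine ⟨(t + 2 * π * j, s - t + 2 * π * i), ⟨⟨hj.1, by simp only; linarith⟩, hi.1,
      by simp only; linarith⟩, ?_⟩
    push_cast
    ext <;> simp only
    ring
  have hsign (k : ℤ) : (-1 : ℝ) ^ k * (-1 : ℝ) ^ k = 1 := by
    rw [← mul_zpow]; simp
  have habs (k : ℤ) (x : ℝ) : |(-1 : ℝ) ^ k * x| = |x| := by
    rw [abs_mul, abs_zpow]; simp
  obtain ⟨hts, huv⟩ := H _ _ ((-1 : ℝ) ^ j * u) ((-1 : ℝ) ^ (i + j) * v) hmem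
    (by rw [habs]; exact abs_lt.2 hu) (by rw [habs]; exact abs_lt.2 hv) (by
      rw [hγk, hγk, hξper.add_mul_int_eq_zpow_smul, hξper.add_mul_int_eq_zpow_smul, smul_smul,
        smul_smul, mul_right_comm, hsign, mul_right_comm, hsign, one_mul, one_mul, h])
  refine ⟨-i, ?_, ?_⟩
  · push_cast at hts ⊢
    linarith
  · rw [zpow_add₀ (by norm_num)] at huv
    rw [zpow_neg, inv_eq_of_mul_eq_one_left (hsign i)]
    have h₁ := hsign i
    have h₂ := hsign j
    generalize (-1 : ℝ) ^ i = p at *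
    generalize (-1 : ℝ) ^ j = q at *
    linear_combination (-p * q) * huv - v * q * q * h₁ - (v - p * u) * h₂

theorem seven_sub_cos_ne_zero (x : ℝ) : 7 - cos x ≠ 0 := by
  linarith [cos_le_one x]

/-- A loxodrome winding four times around the tube of the torus with radii `7` and `1`. -/
noncomputable def torusLoxodrome (t : ℝ) : E3 :=
  !₂[48 * cos t / (7 - cos (4 * t)), 48 * sin t / (7 - cos (4 * t)),
    4 * √3 * sin (4 * t) / (7 - cos (4 * t))]

/-- The velocity of `torusLoxodrome`. -/
noncomputable def torusLoxodromeVelocity (t : ℝ) : E3 :=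
  !₂[-(48 * (sin t * (7 - cos (4 * t)) + 4 * cos t * sin (4 * t))) / (7 - cos (4 * t)) ^ 2,
    48 * (cos t * (7 - cos (4 * t)) - 4 * sin t * sin (4 * t)) / (7 - cos (4 * t)) ^ 2,
    16 * √3 * (7 * cos (4 * t) - 1) / (7 - cos (4 * t)) ^ 2]

/-- The unit normal field along `torusLoxodrome` obtained from the normal of the torus by
rotating with constant rate `-7/2` in the normal plane, which makes it parallel. -/
noncomputable def torusLoxodromeDirector (t : ℝ) : E3 :=
  !₂[cos (7 * t / 2) * ((7 * cos (4 * t) - 1) * cos t / (7 - cos (4 * t))) -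
      sin (7 * t / 2) * (sin t - 12 * sin (4 * t) * cos t / (7 - cos (4 * t))) / 2,
    cos (7 * t / 2) * ((7 * cos (4 * t) - 1) * sin t / (7 - cos (4 * t))) +
      sin (7 * t / 2) * (cos t + 12 * sin (4 * t) * sin t / (7 - cos (4 * t))) / 2,
    cos (7 * t / 2) * (4 * √3 * sin (4 * t) / (7 - cos (4 * t))) -
      sin (7 * t / 2) * (√3 * (7 * cos (4 * t) - 1) / (7 - cos (4 * t))) / 2]

/-- A curve in Euclidean 3-space is differentiable as soon as its coordinates are. -/
theorem hasDerivAt_E3 {f : ℝ → E3} {f' : E3} {t : ℝ}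
    (h : ∀ i, HasDerivAt (fun x ↦ f x i) (f' i) t) : HasDerivAt f f' t := by
  have hf := (PiLp.hasFDerivAt_toLp (𝕜 := ℝ) 2 (f t).ofLp).comp_hasDerivAt t (hasDerivAt_pi.2 h)
  exact hf

theorem contDiff_torusLoxodrome {n : WithTop ℕ∞} : ContDiff ℝ n torusLoxodrome := by
  rw [contDiff_euclidean]
  intro i
  fin_cases i <;> simp only [torusLoxodrome] <;> simp <;>
    fun_prop (disch := exact fun x ↦ seven_sub_cos_ne_zero _)

theorem contDiff_torusLoxodromeDirector {n : WithTop ℕ∞} :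
    ContDiff ℝ n torusLoxodromeDirector := by
  rw [contDiff_euclidean]
  intro i
  fin_cases i <;> simp only [torusLoxodromeDirector] <;> simp <;>
    fun_prop (disch := exact fun x ↦ seven_sub_cos_ne_zero _)

section derivatives

variable (t : ℝ)

theorem hasDerivAt_cos_four_mul : HasDerivAt (fun x ↦ cos (4 * x)) (-(4 * sin (4 * t))) t := by
  exact ((hasDerivAt_id' t).const_mul 4).cos.congr_deriv (by ring)

theorem hasDerivAt_sin_four_mul : HasDerivAt (fun x ↦ sin (4 * x)) (4 * cos (4 * t)) t := by
  exact ((hasDerivAt_id' t).const_mul 4).sin.congr_deriv (by ring)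

theorem hasDerivAt_cos_seven_mul_half :
    HasDerivAt (fun x ↦ cos (7 * x / 2)) (-(7 / 2 * sin (7 * t / 2))) t := by
  exact (((hasDerivAt_id' t).const_mul 7).div_const 2).cos.congr_deriv (by ring)

theorem hasDerivAt_sin_seven_mul_half :
    HasDerivAt (fun x ↦ sin (7 * x / 2)) (7 / 2 * cos (7 * t / 2)) t := by
  exact (((hasDerivAt_id' t).const_mul 7).div_const 2).sin.congr_deriv (by ring)

theorem hasDerivAt_torusLoxodrome :
    HasDerivAt torusLoxodrome (torusLoxodromeVelocity t) t := by
  have hD := seven_sub_cos_ne_zero (4 * t)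
  have hD' := (hasDerivAt_cos_four_mul t).const_sub 7
  have h := sin_sq_add_cos_sq (4 * t)
  refine hasDerivAt_E3 fun i ↦ ?_
  fin_cases i
  · refine HasDerivAt.congr_deriv (((hasDerivAt_cos t).const_mul 48).div hD' hD) ?_
    simp [torusLoxodromeVelocity]
    generalize cos (4 * t) = c at *
    generalize sin (4 * t) = s at *
    field_simp
    ring
  · refine HasDerivAt.congr_deriv (((hasDerivAt_sin t).const_mul 48).div hD' hD) ?_
    simp [torusLoxodromeVelocity]
    generalize cos (4 * t) = c at *
    generalize sin (4 * t) = s at *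
    field_simp
  · refine HasDerivAt.congr_deriv (((hasDerivAt_sin_four_mul t).const_mul (4 * √3)).div hD' hD) ?_
    simp [torusLoxodromeVelocity]
    generalize cos (4 * t) = c at *
    generalize sin (4 * t) = s at *
    field_simp
    linear_combination -16 * h

theorem hasDerivAt_torusLoxodromeDirector :
    HasDerivAt torusLoxodromeDirector
      (((cos (7 * t / 2) * (7 * cos (4 * t) + 15) + 8 * sin (7 * t / 2) * sin (4 * t)) / 64) •
        torusLoxodromeVelocity t) t := by
  have hD := seven_sub_cos_ne_zero (4 * t)
  have hc := hasDerivAt_cos_four_mul t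
  have hs := hasDerivAt_sin_four_mul t
  have hC := hasDerivAt_cos_seven_mul_half t
  have hS := hasDerivAt_sin_seven_mul_half t
  have hD' := hc.const_sub 7
  have hP := (hc.const_mul 7).sub_const 1
  have h := sin_sq (4 * t)
  refine hasDerivAt_E3 fun i ↦ ?_
  fin_cases i
  · refine HasDerivAt.congr_deriv ((hC.mul ((hP.mul (hasDerivAt_cos t)).div hD' hD)).sub
      ((hS.mul ((hasDerivAt_sin t).sub
        (((hs.const_mul 12).mul (hasDerivAt_cos t)).div hD' hD))).div_const 2)) ?_
    simp [torusLoxodromeVelocity]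
    generalize cos (4 * t) = c at *
    generalize sin (4 * t) = s at *
    field_simp
    ring
  · refine HasDerivAt.congr_deriv ((hC.mul ((hP.mul (hasDerivAt_sin t)).div hD' hD)).add
      ((hS.mul ((hasDerivAt_cos t).add
        (((hs.const_mul 12).mul (hasDerivAt_sin t)).div hD' hD))).div_const 2)) ?_
    simp [torusLoxodromeVelocity]
    generalize cos (4 * t) = c at *
    generalize sin (4 * t) = s at *
    field_simp
    ring
  · refine HasDerivAt.congr_deriv ((hC.mul ((hs.const_mul (4 * √3)).div hD' hD)).sub
      ((hS.mul ((hP.const_mul √3).div hD' hD)).div_const 2)) ?_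
    simp [torusLoxodromeVelocity]
    generalize cos (4 * t) = c at *
    generalize sin (4 * t) = s at *
    field_simp
    linear_combination -4096 * cos (7 * t / 2) * h

end derivatives

theorem torusLoxodrome_periodic : Function.Periodic torusLoxodrome (2 * π) := by
  intro t
  have h : 4 * (t + 2 * π) = 4 * t + (4 : ℕ) * (2 * π) := by push_cast; ring
  simp only [torusLoxodrome, h, cos_add_nat_mul_two_pi, sin_add_nat_mul_two_pi, cos_add_two_pi,
    sin_add_two_pi]

theorem torusLoxodromeDirector_antiperiodic :
    Function.Antiperiodic torusLoxodromeDirector (2 * π) := by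
  intro t
  have h : 4 * (t + 2 * π) = 4 * t + (4 : ℕ) * (2 * π) := by push_cast; ring
  have h' : 7 * (t + 2 * π) / 2 = 7 * t / 2 + π + (3 : ℕ) * (2 * π) := by push_cast; ring
  ext i
  fin_cases i <;>
  · simp only [torusLoxodromeDirector, h, h', cos_add_nat_mul_two_pi, sin_add_nat_mul_two_pi,
      cos_add_two_pi, sin_add_two_pi, cos_add_pi, sin_add_pi]
    simp
    ring

theorem torusLoxodromeVelocity_ne_zero (t : ℝ) : torusLoxodromeVelocity t ≠ 0 := by
  intro h
  have hD := seven_sub_cos_ne_zero (4 * t)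
  have h0 : torusLoxodromeVelocity t 0 = 0 := by simp [h]
  have h1 : torusLoxodromeVelocity t 1 = 0 := by simp [h]
  simp [torusLoxodromeVelocity, hD] at h0 h1
  have h2 := sin_sq_add_cos_sq t
  exact hD (by linear_combination -(7 - cos (4 * t)) * h2 + sin t * h0 + cos t * h1)

theorem norm_torusLoxodromeDirector (t : ℝ) : ‖torusLoxodromeDirector t‖ = 1 := by
  have hD := seven_sub_cos_ne_zero (4 * t)
  rw [EuclideanSpace.norm_eq, Real.sqrt_eq_one]
  simp [Fin.sum_univ_three, torusLoxodromeDirector]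
  have h3 : √3 ^ 2 = 3 := Real.sq_sqrt (by norm_num)
  have h := sin_sq (4 * t)
  have h' := sin_sq (7 * t / 2)
  have h'' := sin_sq t
  generalize cos (4 * t) = c at *
  generalize sin (4 * t) = s at *
  generalize cos (7 * t / 2) = C at *
  generalize sin (7 * t / 2) = S at *
  field_simp
  ring_nf
  simp only [h, h', h'', h3]
  ring

theorem dot3_torusLoxodromeDirector_velocity (t : ℝ) :
    dot3 (torusLoxodromeDirector t) (torusLoxodromeVelocity t) = 0 := by
  have hD := seven_sub_cos_ne_zero (4 * t)
  simp [dot3, torusLoxodromeDirector, torusLoxodromeVelocity]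
  have h3 : √3 ^ 2 = 3 := Real.sq_sqrt (by norm_num)
  have h'' := sin_sq t
  have h := sin_sq (4 * t)
  generalize cos (4 * t) = c at *
  generalize sin (4 * t) = s at *
  generalize cos (7 * t / 2) = C at *
  generalize sin (7 * t / 2) = S at *
  field_simp
  ring_nf
  simp only [h, h'', h3]
  ring

theorem torusLoxodrome_injective {t s : ℝ} (h : torusLoxodrome t = torusLoxodrome s) :
    ∃ k : ℤ, s = t + 2 * π * k := by
  have hD (x : ℝ) : 0 < 7 - cos x := by linarith [cos_le_one x]
  have h0 : torusLoxodrome t 0 = torusLoxodrome s 0 := by rw [h]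
  have h1 : torusLoxodrome t 1 = torusLoxodrome s 1 := by rw [h]
  simp [torusLoxodrome] at h0 h1
  rw [div_eq_div_iff (hD _).ne' (hD _).ne'] at h0 h1
  have hsq : (7 - cos (4 * s)) ^ 2 = (7 - cos (4 * t)) ^ 2 := by
    have h2 := sin_sq_add_cos_sq t
    have h3 := sin_sq_add_cos_sq s
    linear_combination (cos t * (7 - cos (4 * s)) + cos s * (7 - cos (4 * t))) / 48 * h0 +
      (sin t * (7 - cos (4 * s)) + sin s * (7 - cos (4 * t))) / 48 * h1 -
      (7 - cos (4 * s)) ^ 2 * h2 + (7 - cos (4 * t)) ^ 2 * h3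
  have heq := (pow_left_inj₀ (hD _).le (hD _).le two_ne_zero).1 hsq
  rw [heq] at h0 h1
  have hcos : cos s = cos t := by
    linear_combination -(mul_right_cancel₀ (hD _).ne' h0) / 48
  have hsin : sin s = sin t := by
    linear_combination -(mul_right_cancel₀ (hD _).ne' h1) / 48
  obtain ⟨k, hk⟩ := Real.Angle.angle_eq_iff_two_pi_dvd_sub.1 (Real.Angle.cos_sin_inj hcos hsin)
  exact ⟨k, by linarith⟩

theorem cross3_smul_self (c : ℝ) (v : E3) : cross3 (c • v) v = 0 := by
  ext i
  fin_cases i <;> simp [cross3] <;> ring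

theorem inner_eq_dot3 (u v : E3) : inner ℝ u v = dot3 v u := by
  simp [PiLp.inner_apply, Fin.sum_univ_three, dot3]

/-- Theorem A: there exists an embedded real-analytic principal Möbius developable. -/
theorem exists_embedded_real_analytic_principal_moebius_developable :
    ∃ (γ ξ : ℝ → E3) (ε : ℝ),
      (∀ t, AnalyticAt ℝ γ t) ∧
      (∀ t, γ (t + 2 * π) = γ t) ∧
      (∀ t, deriv γ t ≠ 0) ∧
      (∀ t, AnalyticAt ℝ ξ t) ∧
      (∀ t, ξ (t + 2 * π) = -ξ t) ∧
      (∀ t, ‖ξ t‖ = 1) ∧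
      (∀ t, dot3 (ξ t) (deriv γ t) = 0) ∧
      (∀ t, cross3 (deriv ξ t) (deriv γ t) = 0) ∧
      0 < ε ∧
      (∀ t s u v : ℝ, u ∈ Set.Ioo (-ε) ε → v ∈ Set.Ioo (-ε) ε →
        γ t + u • ξ t = γ s + v • ξ s →
        ∃ k : ℤ, s = t + 2 * π * k ∧ v = (-1 : ℝ) ^ k * u) := by
  have hγ' (t : ℝ) : deriv torusLoxodrome t = torusLoxodromeVelocity t :=
    (hasDerivAt_torusLoxodrome t).deriv
  have hreg (t : ℝ) : deriv torusLoxodrome t ≠ 0 := by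
    rw [hγ']; exact torusLoxodromeVelocity_ne_zero t
  have horth (t : ℝ) : dot3 (torusLoxodromeDirector t) (deriv torusLoxodrome t) = 0 := by
    rw [hγ']; exact dot3_torusLoxodromeDirector_velocity t
  obtain ⟨ε, hε, hemb⟩ := exists_moebius_strip_embedded contDiff_torusLoxodrome
    contDiff_torusLoxodromeDirector torusLoxodrome_periodic torusLoxodromeDirector_antiperiodic
    hreg norm_torusLoxodromeDirector (fun t ↦ by rw [inner_eq_dot3, horth])
    fun t s h ↦ torusLoxodrome_injective h
  refine ⟨torusLoxodrome, torusLoxodromeDirector, ε,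
    fun t ↦ contDiff_omega_iff_analyticOnNhd.1 contDiff_torusLoxodrome t (mem_univ t),
    torusLoxodrome_periodic, hreg,
    fun t ↦ contDiff_omega_iff_analyticOnNhd.1 contDiff_torusLoxodromeDirector t (mem_univ t),
    torusLoxodromeDirector_antiperiodic, norm_torusLoxodromeDirector, horth, fun t ↦ ?_, hε, hemb⟩
  rw [hγ', (hasDerivAt_torusLoxodromeDirector t).deriv, cross3_smul_self]
end

section
/- There exists a C^∞ curve γ = (x,y,z) : ℝ → ℝ³ with γ(t+2π) = γ(t) and γ'(t) ≠ 0 for all t, injective on [0,2π) (an embedded closed space curve), such that: (1) γ'(t) × γ''(t) = 0 if and only if t ∈ 2πℤ, and the derivative of t ↦ γ'(t) × γ''(t) at t = 0 is nonzero (unique, generic inflection point at t = 0); (2) y'(0) = y''(0) = 0 and y'''(0) ≠ 0; (3) z'(0) = z''(0) = z'''(0) = z''''(0) = 0; and moreover there exists a C^∞ vector field ξ : ℝ → ℝ³ with ξ(t+2π) = −ξ(t), γ'(t) × ξ(t) ≠ 0, det(γ'(t), ξ(t), ξ'(t)) = 0 and ξ'(t)·γ''(t) = 0 for all t (a rectifying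 C^∞ Möbius developable over γ). In particular det(γ'(0), γ'''(0), γ''''(0)) = 0. -/
open Real

open Polynomial in
/-- The coefficient of the director field in the velocity of the centerline, divided by
`sin (t / 2)`, as a polynomial in `sin (t / 2) ^ 2`. -/
noncomputable def directorCoeff : ℝ[X] :=
  393540 - 2044350 * X ^ 2 + 1554255 * X ^ 3 - 1362900 * X ^ 4 + 1239480 * X ^ 5

open Polynomial in
/-- The coefficient of the transversal field in the velocity of the centerline, as a polynomial in
`sin (t / 2) ^ 2`. -/
noncomputable def transversalCoeff : ℝ[X] :=
  131180 - 131180 * X - 65590 * X ^ 2 - 227150 * X ^ 3 + 308235 * X ^ 4 + 454300 * X ^ 5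
    - 413160 * X ^ 6

open Polynomial in
/-- The `x`-coordinate of the centerline, divided by `2 * sin (t / 2) * cos (t / 2)`. -/
noncomputable def xProfile : ℝ[X] :=
  393540 + 262360 * X + 170534 * X ^ 2 - 771108 * X ^ 3 + 541134 * X ^ 4 - 206580 * X ^ 5

open Polynomial in
/-- The `y`-coordinate of the centerline, divided by `2 * sin (t / 2) * cos (t / 2)`. -/
noncomputable def yProfile : ℝ[X] :=
  131180 * X + 104944 * X ^ 2 + 61842 * X ^ 3 - 247896 * X ^ 4

open Polynomial in
/-- Half the `z`-coordinate of the centerline. -/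
noncomputable def zProfile : ℝ[X] :=
  -615860 * X ^ 3 + C (4280055 / 4) * X ^ 4 - 768372 * X ^ 5 + 206580 * X ^ 6

open Polynomial in
/-- The `x`-component of the velocity of the centerline. -/
noncomputable def xVelocity : ℝ[X] :=
  X * (3 - 2 * X) * directorCoeff + (3 - 6 * X) * transversalCoeff

open Polynomial in
/-- The `y`-component of the velocity of the centerline. -/
noncomputable def yVelocity : ℝ[X] :=
  X ^ 2 * directorCoeff + 3 * X * transversalCoeff

open Polynomial in
/-- The `z`-component of the velocity of the centerline, divided by `sin (t / 2) * cos (t / 2)`. -/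
noncomputable def zVelocity : ℝ[X] :=
  2 * (1 - X) * directorCoeff - 6 * transversalCoeff

/-- The rectifying condition, as a differential equation for the coefficients of the velocity. -/
theorem rectifying_equation (S : ℝ) :
    (directorCoeff.eval S + 2 * S * directorCoeff.derivative.eval S) * (S ^ 2 - 1)
      + 3 * directorCoeff.eval S * (1 + S ^ 2)
      + 6 * transversalCoeff.derivative.eval S * (1 + S ^ 2)
      + 6 * transversalCoeff.eval S * S = 0 := by
  simp [directorCoeff, transversalCoeff]
  ring

theorem transversalCoeff_pos {S : ℝ} (h0 : 0 ≤ S) (h1 : S ≤ 1) : 0 < transversalCoeff.eval S := by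
  obtain ⟨r, hr⟩ : ∃ r, r = 1 - S := ⟨_, rfl⟩
  have hr0 : 0 ≤ r := by linarith
  have key : transversalCoeff.eval S = 7000 + (124180 * r ^ 7 + 738080 * S * r ^ 6
      + 1755110 * S ^ 2 * r ^ 5 + 1823500 * S ^ 3 * r ^ 4 + 466435 * S ^ 4 * r ^ 3
      + 285 * S ^ 5 * r ^ 2 + 265775 * S ^ 6 * r + 49635 * S ^ 7) := by
    simp [transversalCoeff, hr]
    ring
  rw [key]
  positivity

theorem xProfile_equation (S : ℝ) :
    (1 - 2 * S) * xProfile.eval S + 2 * S * (1 - S) * xProfile.derivative.eval S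
      = xVelocity.eval S := by
  simp [xProfile, xVelocity, directorCoeff, transversalCoeff]
  ring

theorem yProfile_equation (S : ℝ) :
    (1 - 2 * S) * yProfile.eval S + 2 * S * (1 - S) * yProfile.derivative.eval S
      = yVelocity.eval S := by
  simp [yProfile, yVelocity, directorCoeff, transversalCoeff]
  ring

theorem zProfile_equation (S : ℝ) :
    2 * zProfile.derivative.eval S = zVelocity.eval S := by
  simp [zProfile, zVelocity, directorCoeff, transversalCoeff]
  ring

theorem zVelocity_eval (S : ℝ) :
    zVelocity.eval S
      = S ^ 2 * (2 * (-1847580 + 4280055 * S - 3841860 * S ^ 2 + 1239480 * S ^ 3)) := by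
  simp [zVelocity, directorCoeff, transversalCoeff]
  ring

theorem yProfile_pos {S : ℝ} (h0 : 0 < S) (h1 : S ≤ 1) : 0 < yProfile.eval S := by
  have h : yProfile.eval S = S * (131180 + 104944 * S + 61842 * S ^ 2 - 247896 * S ^ 3) := by
    simp [yProfile]
    ring
  rw [h]
  have h2 : S ^ 3 ≤ S ^ 2 := pow_le_pow_of_le_one h0.le h1 (by norm_num)
  have h3 : S ^ 2 ≤ S := by nlinarith
  exact mul_pos h0 (by linarith)

theorem zProfile_strictAntiOn : StrictAntiOn (fun S => zProfile.eval S) (Set.Icc 0 1) := by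
  refine strictAntiOn_of_deriv_neg (convex_Icc 0 1) zProfile.continuous.continuousOn fun S hS => ?_
  rw [interior_Icc] at hS
  rw [Polynomial.deriv]
  have hz := zProfile_equation S
  rw [zVelocity_eval] at hz
  have hS2 : 0 < S ^ 2 := pow_pos hS.1 2
  have hc : -1847580 + 4280055 * S - 3841860 * S ^ 2 + 1239480 * S ^ 3 < 0 := by
    nlinarith [mul_nonneg hS.1.le (sub_nonneg.2 hS.2.le), mul_nonneg hS.1.le (sq_nonneg (1 - S)),
      mul_nonneg (sub_nonneg.2 hS.2.le) (sq_nonneg (1 - S)), hS.1, hS.2, pow_pos hS.1 3,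
      mul_nonneg hS2.le (sub_nonneg.2 hS.2.le)]
  nlinarith

section Calculus

theorem hasDerivAt_sin_half (t : ℝ) : HasDerivAt (fun t => sin (t / 2)) (cos (t / 2) / 2) t := by
  simpa [div_eq_mul_inv] using ((hasDerivAt_id' t).div_const 2).sin

theorem hasDerivAt_cos_half (t : ℝ) : HasDerivAt (fun t => cos (t / 2)) (-sin (t / 2) / 2) t := by
  simpa [div_eq_mul_inv] using ((hasDerivAt_id' t).div_const 2).cos

theorem cos_half_sq (t : ℝ) : cos (t / 2) ^ 2 = 1 - sin (t / 2) ^ 2 := by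
  rw [cos_sq']

theorem hasDerivAt_sin_half_mul_cos_half (t : ℝ) :
    HasDerivAt (fun t => sin (t / 2) * cos (t / 2)) ((1 - 2 * sin (t / 2) ^ 2) / 2) t :=
  ((hasDerivAt_sin_half t).mul (hasDerivAt_cos_half t)).congr_deriv (by
    linear_combination cos_half_sq t / 2)

theorem hasDerivAt_eval_sin_half_sq (P : Polynomial ℝ) (t : ℝ) :
    HasDerivAt (fun t => P.eval (sin (t / 2) ^ 2))
      (P.derivative.eval (sin (t / 2) ^ 2) * (sin (t / 2) * cos (t / 2))) t := by
  have h := (P.hasDerivAt (sin (t / 2) ^ 2)).comp t ((hasDerivAt_sin_half t).pow 2)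
  exact h.congr_deriv (by push_cast; ring)

theorem hasDerivAt_sin_half_mul_cos_half_mul_eval (P : Polynomial ℝ) (t : ℝ) :
    HasDerivAt (fun t => sin (t / 2) * cos (t / 2) * P.eval (sin (t / 2) ^ 2))
      ((1 - 2 * sin (t / 2) ^ 2) / 2 * P.eval (sin (t / 2) ^ 2)
        + sin (t / 2) ^ 2 * (1 - sin (t / 2) ^ 2) * P.derivative.eval (sin (t / 2) ^ 2)) t :=
  ((hasDerivAt_sin_half_mul_cos_half t).mul (hasDerivAt_eval_sin_half_sq P t)).congr_deriv (by
    linear_combination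
      sin (t / 2) ^ 2 * P.derivative.eval (sin (t / 2) ^ 2) * cos_half_sq t)

theorem contDiff_eval_sin_half_sq (P : Polynomial ℝ) {n : WithTop ℕ∞} :
    ContDiff ℝ n fun t => P.eval (sin (t / 2) ^ 2) := by
  have hP : ContDiff ℝ n fun x : ℝ => P.eval x := by simpa using P.contDiff_aeval (𝕜 := ℝ) n
  exact hP.comp (by fun_prop)

/-- Differentiating lowers the order of vanishing at the zeros of `sin (t / 2)` by one. -/
theorem exists_deriv_sin_half_pow_mul (n : ℕ) {h : ℝ → ℝ} (hh : ContDiff ℝ (⊤ : ℕ∞) h) :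
    ∃ k : ℝ → ℝ, ContDiff ℝ (⊤ : ℕ∞) k ∧ k 0 = (n + 1) / 2 * h 0 ∧
      deriv (fun t => sin (t / 2) ^ (n + 1) * h t) = fun t => sin (t / 2) ^ n * k t := by
  refine ⟨fun t => (n + 1) / 2 * cos (t / 2) * h t + sin (t / 2) * deriv h t, ?_, by simp, ?_⟩
  · have : ContDiff ℝ (⊤ : ℕ∞) (deriv h) := (contDiff_infty_iff_deriv.1 hh).2
    fun_prop
  · funext t
    have hd : HasDerivAt h (deriv h t) t := (hh.differentiable (by simp) t).hasDerivAt
    refine ((((hasDerivAt_sin_half t).pow (n + 1)).mul hd).congr_deriv ?_).deriv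
    simp only [Pi.pow_apply, Nat.cast_add, Nat.cast_one, Nat.add_sub_cancel]
    ring

theorem hasDerivAt_toLp {f g h : ℝ → ℝ} {f' g' h' t : ℝ} (hf : HasDerivAt f f' t)
    (hg : HasDerivAt g g' t) (hh : HasDerivAt h h' t) :
    HasDerivAt (fun t => (!₂[f t, g t, h t] : E3)) !₂[f', g', h'] t := by
  have hp : HasDerivAt (fun t => ![f t, g t, h t]) ![f', g', h'] t := by
    rw [hasDerivAt_pi]
    intro i
    fin_cases i
    exacts [hf, hg, hh]
  exact (PiLp.hasFDerivAt_toLp (𝕜 := ℝ) 2 ![f t, g t, h t]).comp_hasDerivAt t hp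

theorem deriv_apply_E3 {f : ℝ → E3} {t : ℝ} (hf : DifferentiableAt ℝ f t) (i : Fin 3) :
    deriv (fun t => f t i) t = deriv f t i :=
  ((EuclideanSpace.proj (𝕜 := ℝ) i).hasFDerivAt.comp_hasDerivAt t hf.hasDerivAt).deriv

end Calculus

theorem cross3_apply_zero (u v : E3) : cross3 u v 0 = u 1 * v 2 - u 2 * v 1 := rfl

theorem cross3_apply_one (u v : E3) : cross3 u v 1 = u 2 * v 0 - u 0 * v 2 := rfl

theorem cross3_apply_two (u v : E3) : cross3 u v 2 = u 0 * v 1 - u 1 * v 0 := rfl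

theorem ContDiff.cross3 {n : WithTop ℕ∞} {f g : ℝ → E3} (hf : ContDiff ℝ n f)
    (hg : ContDiff ℝ n g) : ContDiff ℝ n fun t => cross3 (f t) (g t) := by
  have hf' := contDiff_euclidean.1 hf
  have hg' := contDiff_euclidean.1 hg
  rw [contDiff_euclidean]
  intro i
  fin_cases i
  exacts [((hf' 1).mul (hg' 2)).sub ((hf' 2).mul (hg' 1)),
    ((hf' 2).mul (hg' 0)).sub ((hf' 0).mul (hg' 2)),
    ((hf' 0).mul (hg' 1)).sub ((hf' 1).mul (hg' 0))]

/-- The centerline. -/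
noncomputable def centerline (t : ℝ) : E3 :=
  !₂[2 * (sin (t / 2) * cos (t / 2) * xProfile.eval (sin (t / 2) ^ 2)),
    2 * (sin (t / 2) * cos (t / 2) * yProfile.eval (sin (t / 2) ^ 2)),
    2 * zProfile.eval (sin (t / 2) ^ 2)]

/-- The velocity of the centerline. -/
noncomputable def velocity (t : ℝ) : E3 :=
  !₂[xVelocity.eval (sin (t / 2) ^ 2), yVelocity.eval (sin (t / 2) ^ 2),
    sin (t / 2) * cos (t / 2) * zVelocity.eval (sin (t / 2) ^ 2)]

/-- The acceleration of the centerline. -/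
noncomputable def acceleration (t : ℝ) : E3 :=
  !₂[xVelocity.derivative.eval (sin (t / 2) ^ 2) * (sin (t / 2) * cos (t / 2)),
    yVelocity.derivative.eval (sin (t / 2) ^ 2) * (sin (t / 2) * cos (t / 2)),
    (1 - 2 * sin (t / 2) ^ 2) / 2 * zVelocity.eval (sin (t / 2) ^ 2)
      + sin (t / 2) ^ 2 * (1 - sin (t / 2) ^ 2) * zVelocity.derivative.eval (sin (t / 2) ^ 2)]

/-- The director field of the strip. -/
noncomputable def director (t : ℝ) : E3 :=
  !₂[3 * sin (t / 2) - 2 * sin (t / 2) ^ 3, sin (t / 2) ^ 3,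
    2 * (cos (t / 2) * (1 - sin (t / 2) ^ 2))]

/-- The derivative of the director field. -/
noncomputable def directorDeriv (t : ℝ) : E3 :=
  !₂[cos (t / 2) / 2 * (3 - 6 * sin (t / 2) ^ 2), cos (t / 2) / 2 * (3 * sin (t / 2) ^ 2),
    -3 * sin (t / 2) * (1 - sin (t / 2) ^ 2)]

theorem hasDerivAt_centerline (t : ℝ) : HasDerivAt centerline (velocity t) t := by
  refine (hasDerivAt_toLp
    ((hasDerivAt_sin_half_mul_cos_half_mul_eval xProfile t).const_mul 2)
    ((hasDerivAt_sin_half_mul_cos_half_mul_eval yProfile t).const_mul 2)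
    ((hasDerivAt_eval_sin_half_sq zProfile t).const_mul 2)).congr_deriv ?_
  rw [velocity, ← xProfile_equation, ← yProfile_equation, ← zProfile_equation]
  congr 2
  · ring
  · congr 1
    · ring
    · congr 1
      ring

theorem deriv_centerline : deriv centerline = velocity :=
  funext fun t => (hasDerivAt_centerline t).deriv

theorem deriv_velocity : deriv velocity = acceleration :=
  funext fun t => (hasDerivAt_toLp (hasDerivAt_eval_sin_half_sq xVelocity t)
    (hasDerivAt_eval_sin_half_sq yVelocity t)
    (hasDerivAt_sin_half_mul_cos_half_mul_eval zVelocity t)).deriv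

theorem hasDerivAt_director (t : ℝ) : HasDerivAt director (directorDeriv t) t := by
  have hs := hasDerivAt_sin_half t
  refine hasDerivAt_toLp (((hs.const_mul 3).sub ((hs.pow 3).const_mul 2)).congr_deriv ?_)
    ((hs.pow 3).congr_deriv ?_)
    ((((hasDerivAt_cos_half t).mul ((hs.pow 2).const_sub 1)).const_mul 2).congr_deriv ?_)
  · push_cast
    ring
  · push_cast
    ring
  · push_cast
    simp only [Pi.pow_apply]
    linear_combination -2 * sin (t / 2) * cos_half_sq t

theorem deriv_director : deriv director = directorDeriv :=
  funext fun t => (hasDerivAt_director t).deriv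

theorem contDiff_centerline : ContDiff ℝ (⊤ : ℕ∞) centerline := by
  have hx := contDiff_eval_sin_half_sq xProfile (n := (⊤ : ℕ∞))
  have hy := contDiff_eval_sin_half_sq yProfile (n := (⊤ : ℕ∞))
  have hz := contDiff_eval_sin_half_sq zProfile (n := (⊤ : ℕ∞))
  rw [contDiff_euclidean]
  intro i
  fin_cases i <;> simp [centerline] <;> fun_prop

theorem contDiff_director : ContDiff ℝ (⊤ : ℕ∞) director := by
  rw [contDiff_euclidean]
  intro i
  fin_cases i <;> simp [director] <;> fun_prop

theorem sin_half_add_two_pi (t : ℝ) : sin ((t + 2 * π) / 2) = -sin (t / 2) := by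
  rw [show (t + 2 * π) / 2 = t / 2 + π by ring, sin_add_pi]

theorem cos_half_add_two_pi (t : ℝ) : cos ((t + 2 * π) / 2) = -cos (t / 2) := by
  rw [show (t + 2 * π) / 2 = t / 2 + π by ring, cos_add_pi]

theorem centerline_add_two_pi (t : ℝ) : centerline (t + 2 * π) = centerline t := by
  simp [centerline, sin_half_add_two_pi, cos_half_add_two_pi]

theorem director_add_two_pi (t : ℝ) : director (t + 2 * π) = -director t := by
  ext i
  fin_cases i <;> simp [director, sin_half_add_two_pi, cos_half_add_two_pi] <;> ring

theorem injOn_centerline : Set.InjOn centerline (Set.Ico 0 (2 * π)) := by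
  intro t ht t' ht' h
  have hs : 0 ≤ sin (t / 2) :=
    sin_nonneg_of_nonneg_of_le_pi (by linarith [ht.1]) (by linarith [ht.2])
  have hs' : 0 ≤ sin (t' / 2) :=
    sin_nonneg_of_nonneg_of_le_pi (by linarith [ht'.1]) (by linarith [ht'.2])
  have hz : zProfile.eval (sin (t / 2) ^ 2) = zProfile.eval (sin (t' / 2) ^ 2) := by
    have := congrArg (fun v : E3 => v 2) h
    simpa [centerline] using this
  have hS := zProfile_strictAntiOn.injOn ⟨sq_nonneg _, sin_sq_le_one _⟩
    ⟨sq_nonneg _, sin_sq_le_one _⟩ hz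
  have hss : sin (t / 2) = sin (t' / 2) := (sq_eq_sq₀ hs hs').1 hS
  rcases hs.eq_or_lt with h0 | hpos
  · have zero_of_sin : ∀ u ∈ Set.Ico 0 (2 * π), sin (u / 2) = 0 → u = 0 := fun u hu hu0 => by
      have := (sin_eq_zero_iff_of_lt_of_lt (by linarith [hu.1, pi_pos])
        (by linarith [hu.2])).1 hu0
      linarith
    rw [zero_of_sin t ht h0.symm, zero_of_sin t' ht' (hss ▸ h0.symm)]
  · have hy : sin (t / 2) * cos (t / 2) * yProfile.eval (sin (t / 2) ^ 2)
        = sin (t' / 2) * cos (t' / 2) * yProfile.eval (sin (t' / 2) ^ 2) := by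
      have := congrArg (fun v : E3 => v 1) h
      simpa [centerline] using this
    rw [← hss] at hy
    have hc := mul_left_cancel₀ hpos.ne'
      (mul_right_cancel₀ (yProfile_pos (pow_pos hpos 2) (sin_sq_le_one _)).ne' hy)
    have := injOn_cos ⟨by linarith [ht.1], by linarith [ht.2]⟩
      ⟨by linarith [ht'.1], by linarith [ht'.2]⟩ hc
    linarith

theorem transversalCoeff_eval_sin_sq_pos (t : ℝ) :
    0 < transversalCoeff.eval (sin (t / 2) ^ 2) :=
  transversalCoeff_pos (sq_nonneg _) (sin_sq_le_one _)

theorem eval_derivative_xVelocity (S : ℝ) :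
    xVelocity.derivative.eval S = (3 - 4 * S) * directorCoeff.eval S
      + S * (3 - 2 * S) * directorCoeff.derivative.eval S - 6 * transversalCoeff.eval S
      + (3 - 6 * S) * transversalCoeff.derivative.eval S := by
  simp [xVelocity]
  ring

theorem eval_derivative_yVelocity (S : ℝ) :
    yVelocity.derivative.eval S = 2 * S * directorCoeff.eval S
      + S ^ 2 * directorCoeff.derivative.eval S + 3 * transversalCoeff.eval S
      + 3 * S * transversalCoeff.derivative.eval S := by
  simp [yVelocity]
  ring

theorem eval_derivative_zVelocity (S : ℝ) :
    zVelocity.derivative.eval S = -2 * directorCoeff.eval S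
      + 2 * (1 - S) * directorCoeff.derivative.eval S
      - 6 * transversalCoeff.derivative.eval S := by
  simp [zVelocity]

theorem eval_xVelocity (S : ℝ) :
    xVelocity.eval S = S * (3 - 2 * S) * directorCoeff.eval S
      + (3 - 6 * S) * transversalCoeff.eval S := by
  simp [xVelocity]

theorem eval_yVelocity (S : ℝ) :
    yVelocity.eval S = S ^ 2 * directorCoeff.eval S + 3 * S * transversalCoeff.eval S := by
  simp [yVelocity]

theorem eval_zVelocity (S : ℝ) :
    zVelocity.eval S = 2 * (1 - S) * directorCoeff.eval S - 6 * transversalCoeff.eval S := by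
  simp [zVelocity]

theorem dot3_cross3_velocity_director (t : ℝ) :
    dot3 !₂[-2 * (sin (t / 2) * cos (t / 2)), sin (t / 2) * cos (t / 2),
        -(1 - 2 * sin (t / 2) ^ 2)] (cross3 (velocity t) (director t))
      = -6 * transversalCoeff.eval (sin (t / 2) ^ 2) * sin (t / 2) := by
  have hc := cos_half_sq t
  simp only [dot3, cross3_apply_zero, cross3_apply_one, cross3_apply_two, velocity, director,
    eval_xVelocity, eval_yVelocity, eval_zVelocity, Matrix.cons_val]
  generalize transversalCoeff.eval (sin (t / 2) ^ 2) = b at *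
  generalize directorCoeff.eval (sin (t / 2) ^ 2) = a at *
  generalize sin (t / 2) = s at *
  generalize cos (t / 2) = c at *
  grind

theorem dot3_director_cross3_velocity_acceleration (t : ℝ) :
    dot3 (director t) (cross3 (velocity t) (acceleration t))
      = 18 * transversalCoeff.eval (sin (t / 2) ^ 2) ^ 2 * sin (t / 2) := by
  have hc := cos_half_sq t
  simp only [dot3, cross3_apply_zero, cross3_apply_one, cross3_apply_two, velocity, director,
    acceleration, eval_xVelocity, eval_yVelocity, eval_zVelocity, eval_derivative_xVelocity,
    eval_derivative_yVelocity, eval_derivative_zVelocity, PiLp.toLp_apply, Matrix.cons_val]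
  generalize transversalCoeff.eval (sin (t / 2) ^ 2) = b at *
  generalize directorCoeff.eval (sin (t / 2) ^ 2) = a at *
  generalize transversalCoeff.derivative.eval (sin (t / 2) ^ 2) = b' at *
  generalize directorCoeff.derivative.eval (sin (t / 2) ^ 2) = a' at *
  generalize sin (t / 2) = s at *
  generalize cos (t / 2) = c at *
  grind

theorem det3_velocity_director_directorDeriv (t : ℝ) :
    det3 (velocity t) (director t) (directorDeriv t) = 0 := by
  have hc := cos_half_sq t
  simp only [det3, dot3, cross3_apply_zero, cross3_apply_one, cross3_apply_two, velocity, director,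
    directorDeriv, eval_xVelocity, eval_yVelocity, eval_zVelocity, PiLp.toLp_apply,
    Matrix.cons_val]
  generalize transversalCoeff.eval (sin (t / 2) ^ 2) = b at *
  generalize directorCoeff.eval (sin (t / 2) ^ 2) = a at *
  generalize sin (t / 2) = s at *
  generalize cos (t / 2) = c at *
  grind

theorem dot3_directorDeriv_acceleration (t : ℝ) :
    dot3 (directorDeriv t) (acceleration t) = 0 := by
  have hc := cos_half_sq t
  have hr := rectifying_equation (sin (t / 2) ^ 2)
  simp only [dot3, directorDeriv, acceleration, eval_zVelocity, eval_derivative_xVelocity,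
    eval_derivative_yVelocity, eval_derivative_zVelocity, PiLp.toLp_apply, Matrix.cons_val]
  generalize transversalCoeff.eval (sin (t / 2) ^ 2) = b at *
  generalize directorCoeff.eval (sin (t / 2) ^ 2) = a at *
  generalize transversalCoeff.derivative.eval (sin (t / 2) ^ 2) = b' at *
  generalize directorCoeff.derivative.eval (sin (t / 2) ^ 2) = a' at *
  generalize sin (t / 2) = s at *
  generalize cos (t / 2) = c at *
  grind

theorem cross3_velocity_director_ne_zero (t : ℝ) : cross3 (velocity t) (director t) ≠ 0 := by
  intro h
  have hb := transversalCoeff_eval_sin_sq_pos t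
  have hd := dot3_cross3_velocity_director t
  rw [h] at hd
  have hs : sin (t / 2) = 0 := by simpa [dot3, hb.ne'] using hd
  have hc : cos (t / 2) ≠ 0 := fun hc => by simpa [hs, hc] using cos_half_sq t
  have h1 : cross3 (velocity t) (director t) 1 = 0 := by rw [h]; rfl
  rw [hs] at hb
  simp [cross3_apply_one, velocity, director, eval_xVelocity, hs, hc] at h1
  norm_num at hb
  exact hb.ne' h1

theorem velocity_ne_zero (t : ℝ) : velocity t ≠ 0 := fun h =>
  cross3_velocity_director_ne_zero t (by rw [h]; ext i; fin_cases i <;> simp [cross3])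

theorem acceleration_eq_zero {t : ℝ} (hs : sin (t / 2) = 0) : acceleration t = 0 := by
  ext i
  fin_cases i <;> simp [acceleration, hs, zVelocity_eval]

theorem cross3_velocity_acceleration_eq_zero_iff (t : ℝ) :
    cross3 (velocity t) (acceleration t) = 0 ↔ ∃ k : ℤ, t = 2 * π * k := by
  constructor
  · intro h
    have hd := dot3_director_cross3_velocity_acceleration t
    rw [h] at hd
    have hs : sin (t / 2) = 0 := by
      simpa [dot3, (transversalCoeff_eval_sin_sq_pos t).ne'] using hd
    obtain ⟨k, hk⟩ := sin_eq_zero_iff.1 hs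
    exact ⟨k, by linarith⟩
  · rintro ⟨k, rfl⟩
    have hs : sin (2 * π * k / 2) = 0 := by
      rw [show 2 * π * k / 2 = k * π by ring, sin_int_mul_pi]
    rw [acceleration_eq_zero hs]
    ext i
    fin_cases i <;> simp [cross3]

theorem deriv_cross3_velocity_acceleration_zero_ne_zero :
    deriv (fun t => cross3 (velocity t) (acceleration t)) 0 ≠ 0 := by
  have hcd : ContDiff ℝ (⊤ : ℕ∞) fun t => cross3 (velocity t) (acceleration t) := by
    have hv : ContDiff ℝ (⊤ : ℕ∞) velocity :=
      deriv_centerline ▸ (contDiff_infty_iff_deriv.1 contDiff_centerline).2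
    exact hv.cross3 (deriv_velocity ▸ (contDiff_infty_iff_deriv.1 hv).2)
  intro h
  have h2 := deriv_apply_E3 (hcd.differentiable (by simp) 0) 2
  rw [h] at h2
  set Q : Polynomial ℝ :=
    xVelocity * yVelocity.derivative - yVelocity * xVelocity.derivative with hQ
  have hfun : (fun t => cross3 (velocity t) (acceleration t) 2)
      = fun t => sin (t / 2) * cos (t / 2) * Q.eval (sin (t / 2) ^ 2) := by
    funext t
    simp [cross3_apply_two, velocity, acceleration, hQ]
    ring
  rw [hfun, (hasDerivAt_sin_half_mul_cos_half_mul_eval Q 0).deriv] at h2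
  simp [hQ, xVelocity, yVelocity, directorCoeff, transversalCoeff] at h2

theorem deriv_apply_centerline (t : ℝ) (i : Fin 3) :
    deriv (fun t => centerline t i) t = velocity t i := by
  rw [deriv_apply_E3 (hasDerivAt_centerline t).differentiableAt, deriv_centerline]

theorem iterate_deriv_apply_centerline (n : ℕ) (i : Fin 3) :
    deriv^[n] (fun t => centerline t i) = fun t => deriv^[n] centerline t i := by
  induction n with
  | zero => rfl
  | succ n ih =>
    have hd := (contDiff_infty_iff_deriv.1 (contDiff_centerline.iterate_deriv n)).1
    funext t
    rw [Function.iterate_succ_apply', Function.iterate_succ_apply', ih, deriv_apply_E3 (hd t)]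

theorem derivs_y_centerline_zero :
    deriv (fun t => centerline t 1) 0 = 0 ∧ deriv^[2] (fun t => centerline t 1) 0 = 0 ∧
      deriv^[3] (fun t => centerline t 1) 0 ≠ 0 := by
  have ha := contDiff_eval_sin_half_sq directorCoeff (n := (⊤ : ℕ∞))
  have hb := contDiff_eval_sin_half_sq transversalCoeff (n := (⊤ : ℕ∞))
  obtain ⟨k₁, hk₁, hk₁0, hd₁⟩ := exists_deriv_sin_half_pow_mul 1
    (h := fun t => sin (t / 2) ^ 2 * directorCoeff.eval (sin (t / 2) ^ 2)
      + 3 * transversalCoeff.eval (sin (t / 2) ^ 2)) (by fun_prop)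
  obtain ⟨k₂, hk₂, hk₂0, hd₂⟩ := exists_deriv_sin_half_pow_mul 0 hk₁
  have hv : deriv (fun t => centerline t 1) = fun t => sin (t / 2) ^ (1 + 1) *
      (sin (t / 2) ^ 2 * directorCoeff.eval (sin (t / 2) ^ 2)
        + 3 * transversalCoeff.eval (sin (t / 2) ^ 2)) := by
    funext t
    rw [deriv_apply_centerline]
    simp [velocity, eval_yVelocity]
    ring
  rw [zero_add] at hd₂
  simp only [Function.iterate_succ, Function.iterate_zero, Function.comp_apply, id_eq, hv, hd₁, hd₂]
  simp [hk₂0, hk₁0, transversalCoeff]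

theorem derivs_z_centerline_zero :
    deriv (fun t => centerline t 2) 0 = 0 ∧ deriv^[2] (fun t => centerline t 2) 0 = 0 ∧
      deriv^[3] (fun t => centerline t 2) 0 = 0 ∧ deriv^[4] (fun t => centerline t 2) 0 = 0 := by
  obtain ⟨k₁, hk₁, -, hd₁⟩ := exists_deriv_sin_half_pow_mul 4
    (h := fun t => cos (t / 2) * (2 * (-1847580 + 4280055 * sin (t / 2) ^ 2
      - 3841860 * (sin (t / 2) ^ 2) ^ 2 + 1239480 * (sin (t / 2) ^ 2) ^ 3))) (by fun_prop)
  obtain ⟨k₂, hk₂, -, hd₂⟩ := exists_deriv_sin_half_pow_mul 3 hk₁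
  obtain ⟨k₃, -, -, hd₃⟩ := exists_deriv_sin_half_pow_mul 2 hk₂
  have hv : deriv (fun t => centerline t 2) = fun t => sin (t / 2) ^ (4 + 1) *
      (cos (t / 2) * (2 * (-1847580 + 4280055 * sin (t / 2) ^ 2
        - 3841860 * (sin (t / 2) ^ 2) ^ 2 + 1239480 * (sin (t / 2) ^ 2) ^ 3))) := by
    funext t
    rw [deriv_apply_centerline]
    simp [velocity, zVelocity_eval]
    ring
  norm_num only at hd₂ hd₃
  simp only [Function.iterate_succ, Function.iterate_zero, Function.comp_apply, id_eq, hv, hd₁, hd₂,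
    hd₃]
  simp

theorem det3_derivs_centerline_zero :
    det3 (deriv centerline 0) (deriv (deriv (deriv centerline)) 0)
      (deriv (deriv (deriv (deriv centerline))) 0) = 0 := by
  obtain ⟨h1, -, h3, h4⟩ := derivs_z_centerline_zero
  have h1' : deriv centerline 0 2 = 0 := by
    rwa [deriv_apply_centerline, ← deriv_centerline] at h1
  rw [iterate_deriv_apply_centerline] at h3 h4
  have h3' : deriv (deriv (deriv centerline)) 0 2 = 0 := h3
  have h4' : deriv (deriv (deriv (deriv centerline))) 0 2 = 0 := h4
  simp [det3, dot3, cross3_apply_zero, cross3_apply_one, cross3_apply_two, h1', h3', h4']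

/-- There exists an embedded closed smooth curve with a unique generic inflection point
at t = 0, normalized derivative conditions on its y- and z-components, carrying a
rectifying smooth Möbius developable. -/
theorem exists_rectifying_moebius_developable_with_admissible_centerline :
    ∃ γ : ℝ → E3,
      ContDiff ℝ (⊤ : ℕ∞) γ ∧
      (∀ t, γ (t + 2 * π) = γ t) ∧
      (∀ t, deriv γ t ≠ 0) ∧
      Set.InjOn γ (Set.Ico 0 (2 * π)) ∧
      -- (1) unique, generic inflection point at t = 0
      (∀ t, cross3 (deriv γ t) (deriv (deriv γ) t) = 0 ↔ ∃ k : ℤ, t = 2 * π * k) ∧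
      deriv (fun t => cross3 (deriv γ t) (deriv (deriv γ) t)) 0 ≠ 0 ∧
      -- (2) conditions on the y-component
      deriv (fun t => γ t 1) 0 = 0 ∧
      iteratedDeriv 2 (fun t => γ t 1) 0 = 0 ∧
      iteratedDeriv 3 (fun t => γ t 1) 0 ≠ 0 ∧
      -- (3) conditions on the z-component
      deriv (fun t => γ t 2) 0 = 0 ∧
      iteratedDeriv 2 (fun t => γ t 2) 0 = 0 ∧
      iteratedDeriv 3 (fun t => γ t 2) 0 = 0 ∧
      iteratedDeriv 4 (fun t => γ t 2) 0 = 0 ∧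
      -- a rectifying smooth Möbius developable over γ
      (∃ ξ : ℝ → E3,
        ContDiff ℝ (⊤ : ℕ∞) ξ ∧
        (∀ t, ξ (t + 2 * π) = -ξ t) ∧
        (∀ t, cross3 (deriv γ t) (ξ t) ≠ 0) ∧
        (∀ t, det3 (deriv γ t) (ξ t) (deriv ξ t) = 0) ∧
        (∀ t, dot3 (deriv ξ t) (deriv (deriv γ) t) = 0)) ∧
      -- in particular
      det3 (deriv γ 0) (deriv (deriv (deriv γ)) 0) (deriv (deriv (deriv (deriv γ)))  0) = 0 := by
  obtain ⟨hy1, hy2, hy3⟩ := derivs_y_centerline_zero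
  obtain ⟨hz1, hz2, hz3, hz4⟩ := derivs_z_centerline_zero
  rw [← iteratedDeriv_eq_iterate] at hy2 hy3 hz2 hz3 hz4
  refine ⟨centerline, contDiff_centerline, centerline_add_two_pi, ?_, injOn_centerline, ?_, ?_,
    hy1, hy2, hy3, hz1, hz2, hz3, hz4,
    ⟨director, contDiff_director, director_add_two_pi, ?_, ?_, ?_⟩, det3_derivs_centerline_zero⟩
  all_goals simp only [deriv_centerline, deriv_velocity, deriv_director]
  exacts [velocity_ne_zero, cross3_velocity_acceleration_eq_zero_iff,
    deriv_cross3_velocity_acceleration_zero_ne_zero, cross3_velocity_director_ne_zero,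
    det3_velocity_director_directorDeriv, dot3_directorDeriv_acceleration]
end

section
/- Let γ = (x,y,z) : ℝ → ℝ³ be a C^∞ curve with γ(t+2π) = γ(t) and γ'(t) ≠ 0 for all t, satisfying: (1) γ'(t) × γ''(t) = 0 if and only if t ∈ 2πℤ, with the derivative of t ↦ γ'(t) × γ''(t) nonzero at t = 0; (2) y'(0) = y''(0) = 0 and y'''(0) ≠ 0; (3) z'(0) = z''(0) = z'''(0) = z''''(0) = 0. Then for every ε > 0 and every integer k₀ ≥ 0 there exists a real-analytic curve Γ : ℝ → ℝ³ with Γ(t+2π) = Γ(t) and Γ'(t) ≠ 0 for all t, which also satisfies conditions (1), (2), (3), and such that ‖Γ^{(k)}(t) − γ^{(k)}(t)‖ < ε for all t ∈ ℝ and all 0 ≤ k ≤ k₀. (Real-analytic approximation, via truncated Fourier series corrected by trigonometric polynomials, preserving the generic inflection and the derivative conditions at t = 0.) -/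
open Real

/-- The real trigonometric polynomials, as a space of functions on the line. -/
noncomputable def trigPoly : Submodule ℝ (ℝ → ℝ) :=
  Submodule.span ℝ (Set.range (fun (n : ℤ) (t : ℝ) => cos (n * t)) ∪
    Set.range (fun (n : ℤ) (t : ℝ) => sin (n * t)))

namespace trigPoly

theorem cos_mem (n : ℤ) : (fun t : ℝ => cos (n * t)) ∈ trigPoly :=
  Submodule.subset_span (Or.inl ⟨n, rfl⟩)

theorem sin_mem (n : ℤ) : (fun t : ℝ => sin (n * t)) ∈ trigPoly :=
  Submodule.subset_span (Or.inr ⟨n, rfl⟩)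

theorem const_mem (c : ℝ) : (fun _ : ℝ => c) ∈ trigPoly := by
  convert trigPoly.smul_mem c (cos_mem 0) using 1
  ext t
  simp

theorem contDiff {p : ℝ → ℝ} (hp : p ∈ trigPoly) {n : WithTop ℕ∞} : ContDiff ℝ n p := by
  induction hp using Submodule.span_induction with
  | mem p h =>
    rcases h with ⟨n, rfl⟩ | ⟨n, rfl⟩
    · exact Real.contDiff_cos.comp (contDiff_const.mul contDiff_id)
    · exact Real.contDiff_sin.comp (contDiff_const.mul contDiff_id)
  | zero => exact contDiff_const
  | add p q _ _ hp hq => exact hp.add hq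
  | smul a p _ hp => exact contDiff_const.smul hp

theorem periodic {p : ℝ → ℝ} (hp : p ∈ trigPoly) : Function.Periodic p (2 * π) := by
  induction hp using Submodule.span_induction with
  | mem p h =>
    rcases h with ⟨n, rfl⟩ | ⟨n, rfl⟩ <;> intro t
    · simp only [mul_add]
      exact Real.cos_add_int_mul_two_pi (n * t) n
    · simp only [mul_add]
      exact Real.sin_add_int_mul_two_pi (n * t) n
  | zero => exact fun _ => rfl
  | add p q _ _ hp hq => exact hp.add hq
  | smul a p _ hp => exact hp.smul a

/-- Up to a constant, a trigonometric polynomial has a trigonometric primitive. -/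
theorem exists_primitive {p : ℝ → ℝ} (hp : p ∈ trigPoly) :
    ∃ q ∈ trigPoly, ∃ c : ℝ, ∀ t, HasDerivAt q (p t - c) t := by
  induction hp using Submodule.span_induction with
  | mem p h =>
    rcases h with ⟨n, rfl⟩ | ⟨n, rfl⟩
    · by_cases hn : n = 0
      · exact ⟨0, zero_mem _, 1, fun t => by simp [hn]⟩
      · have hn' : (n : ℝ) ≠ 0 := by exact_mod_cast hn
        refine ⟨(n : ℝ)⁻¹ • fun t : ℝ => sin (n * t), trigPoly.smul_mem _ (sin_mem n), 0,
          fun t => ?_⟩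
        refine (((hasDerivAt_id t).const_mul (n : ℝ)).sin.const_smul (n : ℝ)⁻¹).congr_deriv ?_
        simp
        field_simp
    · by_cases hn : n = 0
      · exact ⟨0, zero_mem _, 0, fun t => by simp [hn]⟩
      · have hn' : (n : ℝ) ≠ 0 := by exact_mod_cast hn
        refine ⟨(-(n : ℝ)⁻¹) • fun t : ℝ => cos (n * t), trigPoly.smul_mem _ (cos_mem n), 0,
          fun t => ?_⟩
        refine (((hasDerivAt_id t).const_mul (n : ℝ)).cos.const_smul (-(n : ℝ)⁻¹)).congr_deriv ?_
        simp
        field_simp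
  | zero => exact ⟨0, zero_mem _, 0, fun t => by simp⟩
  | add p q _ _ hp hq =>
    obtain ⟨P, hP, c, hPc⟩ := hp
    obtain ⟨Q, hQ, d, hQd⟩ := hq
    refine ⟨P + Q, add_mem hP hQ, c + d, fun t => ?_⟩
    refine ((hPc t).add (hQd t)).congr_deriv ?_
    simp only [Pi.add_apply]
    ring
  | smul a p _ hp =>
    obtain ⟨P, hP, c, hPc⟩ := hp
    refine ⟨a • P, trigPoly.smul_mem a hP, a * c, fun t => ?_⟩
    refine ((hPc t).const_smul a).congr_deriv ?_
    simp only [Pi.smul_apply, smul_eq_mul]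
    ring

theorem re_im_mem_of_mem_span_fourier {F : C(AddCircle (2 * π), ℂ)}
    (hF : F ∈ Submodule.span ℂ (Set.range (fourier (T := 2 * π)))) :
    (fun t : ℝ => (F t).re) ∈ trigPoly ∧ (fun t : ℝ => (F t).im) ∈ trigPoly := by
  induction hF using Submodule.span_induction with
  | mem F h =>
    obtain ⟨n, rfl⟩ := h
    have hexp : ∀ t : ℝ, fourier n (t : AddCircle (2 * π)) =
        Complex.exp (((n * t : ℝ) : ℂ) * Complex.I) := fun t => by
      rw [fourier_coe_apply]
      congr 1
      push_cast
      field_simp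
    simp only [hexp, Complex.exp_ofReal_mul_I_re, Complex.exp_ofReal_mul_I_im]
    exact ⟨cos_mem n, sin_mem n⟩
  | zero => exact ⟨zero_mem _, zero_mem _⟩
  | add F G _ _ hF hG => exact ⟨add_mem hF.1 hG.1, add_mem hF.2 hG.2⟩
  | smul a F _ hF =>
    constructor
    · convert sub_mem (trigPoly.smul_mem a.re hF.1) (trigPoly.smul_mem a.im hF.2) using 1
      ext t
      simp
    · convert add_mem (trigPoly.smul_mem a.re hF.2) (trigPoly.smul_mem a.im hF.1) using 1
      ext t
      simp

theorem exists_approx {f : ℝ → ℝ} (hf : Continuous f) (hper : Function.Periodic f (2 * π))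
    {ε : ℝ} (hε : 0 < ε) : ∃ p ∈ trigPoly, ∀ t, |p t - f t| < ε := by
  have : Fact (0 < 2 * π) := ⟨two_pi_pos⟩
  let F : C(AddCircle (2 * π), ℂ) :=
    ⟨fun x => (hper.lift x : ℂ), Complex.continuous_ofReal.comp (hf.quotient_lift _)⟩
  have hF : F ∈ (Submodule.span ℂ (Set.range (fourier (T := 2 * π)))).topologicalClosure := by
    rw [span_fourier_closure_eq_top]
    trivial
  obtain ⟨G, hG, hGF⟩ := Metric.mem_closure_iff.1 hF ε hε
  refine ⟨_, (re_im_mem_of_mem_span_fourier hG).1, fun t => ?_⟩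
  have h1 : ‖G t - F t‖ < ε := by
    rw [← dist_eq_norm]
    exact (ContinuousMap.dist_apply_le_dist _).trans_lt (by rwa [dist_comm])
  have h2 : (F t).re = f t := by simp [F]
  rw [← h2, ← Complex.sub_re]
  exact (Complex.abs_re_le_norm _).trans_lt h1

end trigPoly

theorem Function.Periodic.deriv {E : Type*} [NormedAddCommGroup E] [NormedSpace ℝ E]
    {f : ℝ → E} {T : ℝ} (hf : Function.Periodic f T) : Function.Periodic (deriv f) T := by
  intro t
  rw [← deriv_comp_add_const, hf.funext]

theorem exists_trigPoly_approx_iteratedDeriv (k : ℕ) {f : ℝ → ℝ} (hf : ContDiff ℝ (⊤ : ℕ∞) f)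
    (hper : Function.Periodic f (2 * π)) {ε : ℝ} (hε : 0 < ε) :
    ∃ p ∈ trigPoly, ∀ j ≤ k, ∀ t, |iteratedDeriv j p t - iteratedDeriv j f t| < ε := by
  induction k generalizing f ε with
  | zero =>
    obtain ⟨p, hp, h⟩ := trigPoly.exists_approx hf.continuous hper hε
    refine ⟨p, hp, fun j hj t => ?_⟩
    obtain rfl : j = 0 := by omega
    simpa using h t
  | succ k ih =>
    have hf' : ContDiff ℝ (⊤ : ℕ∞) (deriv f) := (contDiff_infty_iff_deriv.1 hf).2
    have hfd : Differentiable ℝ f := hf.differentiable (by simp)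
    obtain ⟨δ, hδ, hδε, hδε'⟩ : ∃ δ > 0, 2 * δ < ε ∧ 2 * δ * (2 * π) < ε := by
      refine ⟨ε / (4 * (1 + 2 * π)), by positivity, ?_, ?_⟩ <;>
      · have := pi_pos
        field_simp
        nlinarith
    obtain ⟨h, hh, hclose⟩ := ih hf' hper.deriv hδ
    obtain ⟨q, hq, c, hqc⟩ := trigPoly.exists_primitive hh
    -- The constant `c` is small because `q - f` is periodic.
    have hd : ∀ t, HasDerivAt (fun s => q s - f s) (h t - c - deriv f t) t :=
      fun t => (hqc t).sub (hfd t).hasDerivAt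
    have hc : |c| < δ := by
      obtain ⟨s, -, hs⟩ := exists_hasDerivAt_eq_zero (f := fun s => q s - f s) two_pi_pos
        (fun s _ => (hd s).continuousAt.continuousWithinAt)
        (by simpa using ((trigPoly.periodic hq).sub hper 0).symm) (fun s _ => hd s)
      have := hclose 0 (Nat.zero_le _) s
      rw [iteratedDeriv_zero, iteratedDeriv_zero] at this
      rwa [show c = h s - deriv f s by linarith]
    have hbound : ∀ t, |h t - c - deriv f t| < 2 * δ := fun t => by
      have := hclose 0 (Nat.zero_le _) t
      rw [iteratedDeriv_zero, iteratedDeriv_zero] at this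
      rw [abs_lt] at *
      constructor <;> linarith
    refine ⟨q + fun _ => f 0 - q 0, add_mem hq (trigPoly.const_mem _), fun j hj t => ?_⟩
    have hderiv : deriv (q + fun _ => f 0 - q 0) = fun t => h t - c := by
      ext t
      exact ((hqc t).add_const _).deriv
    cases j with
    | zero =>
      obtain ⟨s, hs, hts⟩ := ((trigPoly.periodic hq).sub hper).exists_mem_Ico₀ two_pi_pos t
      have hmv := Convex.norm_image_sub_le_of_norm_hasDerivWithin_le (s := Set.univ)
        (x := 0) (y := s) (fun t _ => (hd t).hasDerivWithinAt) (fun t _ => (hbound t).le)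
        convex_univ trivial trivial
      simp only [Real.norm_eq_abs, sub_zero, abs_of_nonneg hs.1] at hmv
      simp only [Pi.sub_apply] at hts
      simp only [iteratedDeriv_zero, Pi.add_apply]
      calc |q t + (f 0 - q 0) - f t| = |q s - f s - (q 0 - f 0)| := by
            rw [← hts]
            ring_nf
        _ ≤ 2 * δ * s := hmv
        _ ≤ 2 * δ * (2 * π) := by
            gcongr
            exact hs.2.le
        _ < ε := hδε'
    | succ j =>
      rw [iteratedDeriv_succ', iteratedDeriv_succ', hderiv]
      cases j with
      | zero => simpa using (hbound t).trans hδε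
      | succ j =>
        have hshift : iteratedDeriv (j + 1) (fun t => h t - c) = iteratedDeriv (j + 1) h := by
          rw [iteratedDeriv_succ', iteratedDeriv_succ', deriv_sub_const_fun]
        rw [hshift]
        linarith [hclose (j + 1) (by omega) t]

theorem iteratedDeriv_trig_order_two (a b c d : ℝ) (k : ℕ) (t : ℝ) :
    iteratedDeriv k
        (fun t => a * cos (1 * t) + b * cos (2 * t) + c * sin (1 * t) + d * sin (2 * t)) t
      = a * iteratedDeriv k cos t + b * (2 ^ k * iteratedDeriv k cos (2 * t))
        + c * iteratedDeriv k sin t + d * (2 ^ k * iteratedDeriv k sin (2 * t)) := by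
  have hc : ∀ r : ℝ, ContDiff ℝ k fun t => cos (r * t) := fun r =>
    Real.contDiff_cos.comp (contDiff_const.mul contDiff_id)
  have hs : ∀ r : ℝ, ContDiff ℝ k fun t => sin (r * t) := fun r =>
    Real.contDiff_sin.comp (contDiff_const.mul contDiff_id)
  have h1 := (contDiff_const (c := a)).mul (hc 1)
  have h2 := (contDiff_const (c := b)).mul (hc 2)
  have h3 := (contDiff_const (c := c)).mul (hs 1)
  have h4 := (contDiff_const (c := d)).mul (hs 2)
  rw [iteratedDeriv_fun_add ((h1.add h2).add h3).contDiffAt h4.contDiffAt,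
    iteratedDeriv_fun_add (h1.add h2).contDiffAt h3.contDiffAt,
    iteratedDeriv_fun_add h1.contDiffAt h2.contDiffAt]
  simp only [iteratedDeriv_const_mul_field, iteratedDeriv_comp_const_mul Real.contDiff_cos,
    iteratedDeriv_comp_const_mul Real.contDiff_sin, one_mul]

/-- A trigonometric polynomial with prescribed derivatives of orders one to four at the origin,
all of whose derivatives are controlled by the prescribed values. -/
theorem exists_trigPoly_iteratedDeriv_zero_eq (v : ℕ → ℝ) {δ : ℝ}
    (hv : ∀ k ∈ Set.Icc 1 4, |v k| ≤ δ) :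
    ∃ q ∈ trigPoly, (∀ k ∈ Set.Icc 1 4, iteratedDeriv k q 0 = v k) ∧
      ∀ k t, |iteratedDeriv k q t| ≤ 2 ^ k * (5 * δ) := by
  refine ⟨fun t => (-(4 * v 2 + v 4) / 3) * cos (1 * t) + ((v 2 + v 4) / 12) * cos (2 * t) +
    ((4 * v 1 + v 3) / 3) * sin (1 * t) + (-(v 1 + v 3) / 6) * sin (2 * t), ?_, ?_, ?_⟩
  · have h := add_mem (add_mem (add_mem
      (trigPoly.smul_mem (-(4 * v 2 + v 4) / 3) (trigPoly.cos_mem 1))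
      (trigPoly.smul_mem ((v 2 + v 4) / 12) (trigPoly.cos_mem 2)))
      (trigPoly.smul_mem ((4 * v 1 + v 3) / 3) (trigPoly.sin_mem 1)))
      (trigPoly.smul_mem (-(v 1 + v 3) / 6) (trigPoly.sin_mem 2))
    convert h using 1
    ext t
    simp
  · rintro k ⟨hk1, hk4⟩
    rw [iteratedDeriv_trig_order_two]
    interval_cases k <;> simp <;> ring
  · intro k t
    have h1 := hv 1 (by simp)
    have h2 := hv 2 (by simp)
    have h3 := hv 3 (by simp)
    have h4 := hv 4 (by simp)
    have hk : (1 : ℝ) ≤ 2 ^ k := one_le_pow₀ (by norm_num)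
    have hmul : ∀ a b x y : ℝ, |a| ≤ b → |x| ≤ y → |a * x| ≤ b * y := fun a b x y ha hx => by
      rw [abs_mul]
      exact mul_le_mul ha hx (abs_nonneg _) ((abs_nonneg _).trans ha)
    have hpow : ∀ x : ℝ, |x| ≤ 1 → |2 ^ k * x| ≤ 2 ^ k := fun x hx => by
      simpa using hmul (2 ^ k) (2 ^ k) x 1 (by simp) hx
    have b1 := hmul (-(4 * v 2 + v 4) / 3) (5 / 3 * δ) _ _
      (by rw [abs_le] at *; constructor <;> linarith) ((abs_iteratedDeriv_cos_le_one k t).trans hk)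
    have b2 := hmul ((v 2 + v 4) / 12) (δ / 6) _ _ (by rw [abs_le] at *; constructor <;> linarith)
      (hpow _ (abs_iteratedDeriv_cos_le_one k (2 * t)))
    have b3 := hmul ((4 * v 1 + v 3) / 3) (5 / 3 * δ) _ _
      (by rw [abs_le] at *; constructor <;> linarith) ((abs_iteratedDeriv_sin_le_one k t).trans hk)
    have b4 := hmul (-(v 1 + v 3) / 6) (δ / 3) _ _ (by rw [abs_le] at *; constructor <;> linarith)
      (hpow _ (abs_iteratedDeriv_sin_le_one k (2 * t)))
    have hδ : 0 ≤ 2 ^ k * δ := mul_nonneg (by positivity) ((abs_nonneg _).trans h1)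
    rw [iteratedDeriv_trig_order_two]
    refine (abs_add_le _ _).trans ?_
    refine (add_le_add_left
      ((abs_add_le _ _).trans (add_le_add_left (abs_add_le _ _) _)) _).trans ?_
    linarith

theorem exists_trigPoly_approx_iteratedDeriv_eq (k : ℕ) {f : ℝ → ℝ}
    (hf : ContDiff ℝ (⊤ : ℕ∞) f) (hper : Function.Periodic f (2 * π)) {ε : ℝ} (hε : 0 < ε) :
    ∃ p ∈ trigPoly, (∀ j ∈ Set.Icc 1 4, iteratedDeriv j p 0 = iteratedDeriv j f 0) ∧
      ∀ j ≤ k, ∀ t, |iteratedDeriv j p t - iteratedDeriv j f t| < ε := by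
  obtain ⟨δ, hδ, hδε⟩ : ∃ δ > 0, δ + 2 ^ k * (5 * δ) < ε := by
    refine ⟨ε / (2 * (1 + 2 ^ k * 5)), by positivity, ?_⟩
    field_simp
    norm_num
  obtain ⟨p, hp, hpf⟩ := exists_trigPoly_approx_iteratedDeriv (max k 4) hf hper hδ
  obtain ⟨q, hq, hq0, hqb⟩ := exists_trigPoly_iteratedDeriv_zero_eq
    (fun j => iteratedDeriv j f 0 - iteratedDeriv j p 0) (δ := δ) fun j hj => by
      rw [abs_sub_comm]
      exact (hpf j (hj.2.trans (le_max_right _ _)) 0).le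
  have hadd : ∀ j t, iteratedDeriv j (p + q) t = iteratedDeriv j p t + iteratedDeriv j q t :=
    fun j t => iteratedDeriv_add (trigPoly.contDiff hp).contDiffAt (trigPoly.contDiff hq).contDiffAt
  refine ⟨p + q, add_mem hp hq, fun j hj => ?_, fun j hj t => ?_⟩
  · rw [hadd, hq0 j hj]
    ring
  · rw [hadd, add_sub_right_comm]
    have hpow : (2 : ℝ) ^ j ≤ 2 ^ k := pow_le_pow_right₀ (by norm_num) hj
    calc _ ≤ |iteratedDeriv j p t - iteratedDeriv j f t| + |iteratedDeriv j q t| := abs_add_le _ _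
      _ ≤ δ + 2 ^ k * (5 * δ) := by
        gcongr
        · exact (hpf j (hj.trans (le_max_left _ _)) t).le
        · exact (hqb j t).trans (by gcongr)
      _ < ε := hδε

theorem hasDerivAt_euclidean_apply {ι : Type*} [Fintype ι] {f : ℝ → EuclideanSpace ℝ ι}
    {f' : EuclideanSpace ℝ ι} {t : ℝ} (hf : HasDerivAt f f' t) (i : ι) :
    HasDerivAt (fun s => f s i) (f' i) t :=
  (EuclideanSpace.proj (𝕜 := ℝ) i).hasFDerivAt.comp_hasDerivAt t hf

theorem iteratedDeriv_euclidean_apply {ι : Type*} [Fintype ι] {f : ℝ → EuclideanSpace ℝ ι}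
    (hf : ContDiff ℝ (⊤ : ℕ∞) f) (k : ℕ) (i : ι) (t : ℝ) :
    iteratedDeriv k (fun s => f s i) t = iteratedDeriv k f t i := by
  induction k generalizing f t with
  | zero => simp
  | succ k ih =>
    have hd : deriv (fun s => f s i) = fun s => deriv f s i := funext fun s =>
      (hasDerivAt_euclidean_apply (hf.differentiable (by simp) s).hasDerivAt i).deriv
    rw [iteratedDeriv_succ', iteratedDeriv_succ', hd, ih (contDiff_infty_iff_deriv.1 hf).2]

theorem EuclideanSpace.norm_le_sum_abs {ι : Type*} [Fintype ι] (v : EuclideanSpace ℝ ι) :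
    ‖v‖ ≤ ∑ i, |v i| := by
  refine abs_le_of_sq_le_sq' ?_ (Finset.sum_nonneg fun i _ => abs_nonneg (v i)) |>.2
  rw [EuclideanSpace.real_norm_sq_eq]
  simpa using Finset.sum_sq_le_sq_sum_of_nonneg (s := Finset.univ) (f := fun i => |v i|)
    fun i _ => abs_nonneg (v i)

/-- A smooth periodic curve is approximated, together with finitely many derivatives, by a
real-analytic periodic curve with the same derivatives of orders one to four at the origin. -/
theorem exists_analytic_approx_iteratedDeriv_eq {ι : Type*} [Fintype ι]
    {γ : ℝ → EuclideanSpace ℝ ι} (hγ : ContDiff ℝ (⊤ : ℕ∞) γ)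
    (hper : Function.Periodic γ (2 * π)) (k : ℕ) {ε : ℝ} (hε : 0 < ε) :
    ∃ Γ : ℝ → EuclideanSpace ℝ ι, ContDiff ℝ ⊤ Γ ∧ Function.Periodic Γ (2 * π) ∧
      (∀ j ∈ Set.Icc 1 4, iteratedDeriv j Γ 0 = iteratedDeriv j γ 0) ∧
      ∀ j ≤ k, ∀ t, ‖iteratedDeriv j Γ t - iteratedDeriv j γ t‖ < ε := by
  have hδ : 0 < ε / (Fintype.card ι + 1) := by positivity
  choose p hp hp0 hpγ using fun i => exists_trigPoly_approx_iteratedDeriv_eq k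
    (contDiff_euclidean.1 hγ i) (fun t => congrArg (· i) (hper t)) hδ
  have hΓ : ∀ {n : WithTop ℕ∞}, ContDiff ℝ n fun t => WithLp.toLp 2 fun i => p i t :=
    contDiff_euclidean.2 fun i => trigPoly.contDiff (hp i)
  have happ := fun j i t => iteratedDeriv_euclidean_apply hΓ j i t
  refine ⟨_, hΓ, fun t => ?_, fun j hj => ?_, fun j hj t => ?_⟩
  · ext i
    exact trigPoly.periodic (hp i) t
  · ext i
    rw [← happ, ← iteratedDeriv_euclidean_apply hγ]
    exact hp0 i j hj
  · calc _ ≤ ∑ i, |(iteratedDeriv j (fun t => WithLp.toLp 2 fun i => p i t) t -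
            iteratedDeriv j γ t) i| := EuclideanSpace.norm_le_sum_abs _
      _ ≤ ∑ _i : ι, ε / (Fintype.card ι + 1) := by
        refine Finset.sum_le_sum fun i _ => ?_
        rw [PiLp.sub_apply, ← happ, ← iteratedDeriv_euclidean_apply hγ]
        exact (hpγ i j hj t).le
      _ < ε := by
        rw [Finset.sum_const, Finset.card_univ, nsmul_eq_mul]
        field_simp
        linarith

theorem contDiff_cross3 {n : WithTop ℕ∞} : ContDiff ℝ n fun p : E3 × E3 => cross3 p.1 p.2 := by
  have h1 : ∀ i, ContDiff ℝ n fun p : E3 × E3 => p.1 i := contDiff_euclidean.1 contDiff_fst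
  have h2 : ∀ i, ContDiff ℝ n fun p : E3 × E3 => p.2 i := contDiff_euclidean.1 contDiff_snd
  refine contDiff_euclidean.2 fun i => ?_
  fin_cases i
  · exact ((h1 1).mul (h2 2)).sub ((h1 2).mul (h2 1))
  · exact ((h1 2).mul (h2 0)).sub ((h1 0).mul (h2 2))
  · exact ((h1 0).mul (h2 1)).sub ((h1 1).mul (h2 0))

theorem differentiable_cross3_deriv {γ : ℝ → E3} (hγ : ContDiff ℝ (⊤ : ℕ∞) γ) :
    Differentiable ℝ fun t => cross3 (deriv γ t) (deriv (deriv γ) t) := by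
  have hγ₁ := (contDiff_infty_iff_deriv.1 hγ).2
  have hγ₂ := (contDiff_infty_iff_deriv.1 hγ₁).2
  exact ((contDiff_cross3 (n := (⊤ : ℕ∞))).comp (hγ₁.prodMk hγ₂)).differentiable (by simp)

theorem hasDerivAt_cross3_deriv_apply_two {γ : ℝ → E3} (hγ : ContDiff ℝ (⊤ : ℕ∞) γ) (t : ℝ) :
    HasDerivAt (fun t => cross3 (deriv γ t) (deriv (deriv γ) t) 2)
      (cross3 (deriv γ t) (deriv (deriv (deriv γ)) t) 2) t := by
  have hγ₁ := (contDiff_infty_iff_deriv.1 hγ).2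
  have hγ₂ := (contDiff_infty_iff_deriv.1 hγ₁).2
  have h1 := hasDerivAt_euclidean_apply (hγ₁.differentiable (by simp) t).hasDerivAt
  have h2 := hasDerivAt_euclidean_apply (hγ₂.differentiable (by simp) t).hasDerivAt
  refine (((h1 0).mul (h2 1)).sub ((h1 1).mul (h2 0))).congr_deriv ?_
  rw [cross3_apply_two]
  ring

theorem IsCompact.exists_pos_forall_dist_lt_mem {X Y : Type*} [TopologicalSpace X]
    [PseudoMetricSpace Y] {K : Set X} (hK : IsCompact K) {J : X → Y} (hJ : Continuous J)
    {U : Set Y} (hU : IsOpen U) (hKU : ∀ x ∈ K, J x ∈ U) :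
    ∃ δ > 0, ∀ x ∈ K, ∀ y, dist y (J x) < δ → y ∈ U := by
  obtain ⟨δ, hδ, h⟩ := (hK.image hJ).exists_thickening_subset_open hU (Set.image_subset_iff.2 hKU)
  exact ⟨δ, hδ, fun x hx y hy => h (Metric.mem_thickening_iff.2 ⟨J x, ⟨x, hx, rfl⟩, hy⟩)⟩

/-- The derivatives of orders one to three of a curve. -/
noncomputable def threeJet (γ : ℝ → E3) (t : ℝ) : E3 × E3 × E3 :=
  (deriv γ t, deriv (deriv γ) t, deriv (deriv (deriv γ)) t)

theorem continuous_threeJet {γ : ℝ → E3} (hγ : ContDiff ℝ (⊤ : ℕ∞) γ) :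
    Continuous (threeJet γ) := by
  have hγ₁ := (contDiff_infty_iff_deriv.1 hγ).2
  have hγ₂ := (contDiff_infty_iff_deriv.1 hγ₁).2
  exact hγ₁.continuous.prodMk
    (hγ₂.continuous.prodMk (contDiff_infty_iff_deriv.1 hγ₂).2.continuous)

theorem iteratedDeriv_three_eq {E : Type*} [NormedAddCommGroup E] [NormedSpace ℝ E] (f : ℝ → E) :
    iteratedDeriv 3 f = deriv (deriv (deriv f)) := by
  simp [iteratedDeriv_succ', iteratedDeriv_zero]

theorem iteratedDeriv_two_eq {E : Type*} [NormedAddCommGroup E] [NormedSpace ℝ E] (f : ℝ → E) :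
    iteratedDeriv 2 f = deriv (deriv f) := by
  simp [iteratedDeriv_succ', iteratedDeriv_zero]

theorem dist_threeJet_lt {γ Γ : ℝ → E3} {δ t : ℝ}
    (h : ∀ k ≤ 3, ‖iteratedDeriv k Γ t - iteratedDeriv k γ t‖ < δ) :
    dist (threeJet Γ t) (threeJet γ t) < δ := by
  have h1 := h 1 (by norm_num)
  have h2 := h 2 (by norm_num)
  have h3 := h 3 le_rfl
  rw [iteratedDeriv_one, iteratedDeriv_one, ← dist_eq_norm] at h1
  rw [iteratedDeriv_two_eq, iteratedDeriv_two_eq, ← dist_eq_norm] at h2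
  rw [iteratedDeriv_three_eq, iteratedDeriv_three_eq, ← dist_eq_norm] at h3
  exact max_lt h1 (max_lt h2 h3)

/-- If a curve is regular, has a generic inflection point at the origin in the sense that the last
component of `γ' × γ'''` does not vanish there, and has no other inflection point modulo the
period, then regularity and the absence of further inflection points are preserved by small
perturbations of the first three derivatives that keep an inflection point at the origin. -/
theorem exists_pos_forall_inflection_iff {γ : ℝ → E3} (hγ : ContDiff ℝ (⊤ : ℕ∞) γ)
    (hreg : ∀ t, deriv γ t ≠ 0)
    (hinfl : ∀ t, cross3 (deriv γ t) (deriv (deriv γ) t) = 0 → ∃ k : ℤ, t = 2 * π * k)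
    (hgen : cross3 (deriv γ 0) (deriv (deriv (deriv γ)) 0) 2 ≠ 0) :
    ∃ δ > 0, ∀ Γ : ℝ → E3, ContDiff ℝ (⊤ : ℕ∞) Γ → Function.Periodic Γ (2 * π) →
      (∀ t, dist (threeJet Γ t) (threeJet γ t) < δ) →
      cross3 (deriv Γ 0) (deriv (deriv Γ) 0) = 0 →
      (∀ t, deriv Γ t ≠ 0) ∧
      ∀ t, cross3 (deriv Γ t) (deriv (deriv Γ) t) = 0 ↔ ∃ k : ℤ, t = 2 * π * k := by
  have hpi := pi_pos
  have hJ := continuous_threeJet hγ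
  have hU₁ : IsOpen {p : E3 × E3 × E3 | p.1 ≠ 0} := isOpen_ne_fun continuous_fst continuous_const
  have hU₂ : IsOpen {p : E3 × E3 × E3 | cross3 p.1 p.2.1 ≠ 0} :=
    isOpen_ne_fun ((contDiff_cross3 (n := 0)).continuous.comp
      (continuous_fst.prodMk (continuous_fst.comp continuous_snd))) continuous_const
  have hU₃ : IsOpen {p : E3 × E3 × E3 | cross3 p.1 p.2.2 2 ≠ 0} :=
    isOpen_ne_fun ((EuclideanSpace.proj (𝕜 := ℝ) (2 : Fin 3)).continuous.comp
      ((contDiff_cross3 (n := 0)).continuous.comp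
        (continuous_fst.prodMk (continuous_snd.comp continuous_snd)))) continuous_const
  obtain ⟨r, hr, hrπ, hηr⟩ : ∃ r > 0, r < π ∧
      ∀ t ∈ Set.Icc (-r) r, threeJet γ t ∈ {p : E3 × E3 × E3 | cross3 p.1 p.2.2 2 ≠ 0} := by
    obtain ⟨ρ, hρ, h⟩ := Metric.isOpen_iff.1 (hU₃.preimage hJ) 0 hgen
    refine ⟨min (ρ / 2) (π / 2), by positivity, by linarith [min_le_right (ρ / 2) (π / 2)],
      fun t ht => h ?_⟩
    rw [Metric.mem_ball, Real.dist_eq, sub_zero, abs_lt]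
    have := min_le_left (ρ / 2) (π / 2)
    constructor <;> linarith [ht.1, ht.2]
  obtain ⟨δ₁, hδ₁, h₁⟩ := (isCompact_Icc (a := -r) (b := 2 * π - r)).exists_pos_forall_dist_lt_mem
    hJ hU₁ fun t _ => hreg t
  obtain ⟨δ₂, hδ₂, h₂⟩ := (isCompact_Icc (a := r) (b := 2 * π - r)).exists_pos_forall_dist_lt_mem
    hJ hU₂ fun t ht h0 => by
      obtain ⟨k, rfl⟩ := hinfl t h0
      have hk0 : (0 : ℝ) < k := by
        by_contra! hk
        nlinarith [ht.1]
      have hk1 : (k : ℝ) < 1 := by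
        by_contra! hk
        nlinarith [ht.2]
      norm_cast at hk0 hk1
      omega
  obtain ⟨δ₃, hδ₃, h₃⟩ := (isCompact_Icc (a := -r) (b := r)).exists_pos_forall_dist_lt_mem
    hJ hU₃ hηr
  refine ⟨min δ₁ (min δ₂ δ₃), by positivity, fun Γ hΓ hper hclose hzero => ?_⟩
  have hmod : ∀ t, ∃ n : ℤ, t + n • (2 * π) ∈ Set.Ico (-r) (2 * π - r) := fun t => by
    obtain ⟨n, hn, -⟩ := existsUnique_add_zsmul_mem_Ico two_pi_pos t (-r)
    exact ⟨n, by rwa [neg_add_eq_sub] at hn⟩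
  have hcper : Function.Periodic (fun t => cross3 (deriv Γ t) (deriv (deriv Γ) t)) (2 * π) :=
    fun t => by simp only [hper.deriv t, hper.deriv.deriv t]
  refine ⟨fun t => ?_, fun t => ⟨fun ht => ?_, ?_⟩⟩
  · obtain ⟨n, hn⟩ := hmod t
    rw [← hper.deriv.zsmul n t]
    exact h₁ _ (Set.Ico_subset_Icc_self hn) _ ((hclose _).trans_le (min_le_left _ _))
  · obtain ⟨n, hn⟩ := hmod t
    have hs := (hcper.zsmul n t).trans ht
    set s := t + n • (2 * π) with hsdef
    rcases lt_or_ge s r with hsr | hsr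
    · have hne : ∀ x ∈ Set.Icc (-r) r, cross3 (deriv Γ x) (deriv (deriv (deriv Γ)) x) 2 ≠ 0 :=
        fun x hx => h₃ x hx _
          ((hclose x).trans_le ((min_le_right _ _).trans (min_le_right _ _)))
      have hrolle : ∀ a b, a < b → -r ≤ a → b ≤ r →
          cross3 (deriv Γ a) (deriv (deriv Γ) a) = 0 →
          cross3 (deriv Γ b) (deriv (deriv Γ) b) = 0 → False := fun a b hab har hbr ha hb => by
        obtain ⟨x, hx, hx0⟩ := exists_hasDerivAt_eq_zero hab
          (fun x _ => (hasDerivAt_cross3_deriv_apply_two hΓ x).continuousAt.continuousWithinAt)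
          (by rw [ha, hb]) (fun x _ => hasDerivAt_cross3_deriv_apply_two hΓ x)
        exact hne x ⟨har.trans hx.1.le, hx.2.le.trans hbr⟩ hx0
      have hs0 : s = 0 := by
        rcases lt_trichotomy s 0 with h | h | h
        · exact (hrolle s 0 h hn.1 hr.le hs hzero).elim
        · exact h
        · exact (hrolle 0 s h (by linarith) hsr.le hzero hs).elim
      refine ⟨-n, ?_⟩
      rw [hsdef, zsmul_eq_mul] at hs0
      push_cast
      linarith
    · exact (h₂ s ⟨hsr, hn.2.le⟩ _
        ((hclose s).trans_le ((min_le_right _ _).trans (min_le_left _ _))) hs).elim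
  · rintro ⟨k, rfl⟩
    have := hcper.zsmul k 0
    simp only [zero_add, zsmul_eq_mul] at this
    rw [mul_comm, this, hzero]

/-- Real-analytic approximation of an admissible Möbius centerline, preserving the
generic inflection point and the derivative conditions at t = 0. -/
theorem exists_real_analytic_approximation_of_admissible_centerline
    (γ : ℝ → E3)
    (hγ : ContDiff ℝ (⊤ : ℕ∞) γ)
    (hper : ∀ t, γ (t + 2 * π) = γ t)
    (hreg : ∀ t, deriv γ t ≠ 0)
    -- (1)
    (h1 : ∀ t, cross3 (deriv γ t) (deriv (deriv γ) t) = 0 ↔ ∃ k : ℤ, t = 2 * π * k)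
    (h1' : deriv (fun t => cross3 (deriv γ t) (deriv (deriv γ) t)) 0 ≠ 0)
    -- (2)
    (h2a : deriv (fun t => γ t 1) 0 = 0)
    (h2b : iteratedDeriv 2 (fun t => γ t 1) 0 = 0)
    (h2c : iteratedDeriv 3 (fun t => γ t 1) 0 ≠ 0)
    -- (3)
    (h3a : deriv (fun t => γ t 2) 0 = 0)
    (h3b : iteratedDeriv 2 (fun t => γ t 2) 0 = 0)
    (h3c : iteratedDeriv 3 (fun t => γ t 2) 0 = 0)
    (h3d : iteratedDeriv 4 (fun t => γ t 2) 0 = 0) :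
    ∀ ε > (0 : ℝ), ∀ k₀ : ℕ, ∃ Γ : ℝ → E3,
      (∀ t, AnalyticAt ℝ Γ t) ∧
      (∀ t, Γ (t + 2 * π) = Γ t) ∧
      (∀ t, deriv Γ t ≠ 0) ∧
      (∀ t, cross3 (deriv Γ t) (deriv (deriv Γ) t) = 0 ↔ ∃ k : ℤ, t = 2 * π * k) ∧
      deriv (fun t => cross3 (deriv Γ t) (deriv (deriv Γ) t)) 0 ≠ 0 ∧
      deriv (fun t => Γ t 1) 0 = 0 ∧
      iteratedDeriv 2 (fun t => Γ t 1) 0 = 0 ∧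
      iteratedDeriv 3 (fun t => Γ t 1) 0 ≠ 0 ∧
      deriv (fun t => Γ t 2) 0 = 0 ∧
      iteratedDeriv 2 (fun t => Γ t 2) 0 = 0 ∧
      iteratedDeriv 3 (fun t => Γ t 2) 0 = 0 ∧
      iteratedDeriv 4 (fun t => Γ t 2) 0 = 0 ∧
      (∀ t : ℝ, ∀ k ≤ k₀, ‖iteratedDeriv k Γ t - iteratedDeriv k γ t‖ < ε) := by
  intro ε hε k₀
  have happ := fun k i => iteratedDeriv_euclidean_apply hγ k i 0
  have happ₁ := fun i => (happ 1 i).symm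
  simp only [iteratedDeriv_one] at happ₁
  -- At the origin `γ'` is horizontal, so `γ' × γ'''` has a nonzero last component.
  have hgen : cross3 (deriv γ 0) (deriv (deriv (deriv γ)) 0) 2 ≠ 0 := by
    have hx : deriv γ 0 0 ≠ 0 := fun hx => hreg 0 <| by
      ext i
      fin_cases i
      · exact hx
      · exact (happ₁ 1).trans h2a
      · exact (happ₁ 2).trans h3a
    rw [happ 3 1, iteratedDeriv_three_eq] at h2c
    rw [cross3_apply_two, happ₁ 1, h2a, zero_mul, sub_zero]
    exact mul_ne_zero hx h2c
  obtain ⟨δ, hδ, hstable⟩ :=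
    exists_pos_forall_inflection_iff hγ hreg (fun t => (h1 t).1) hgen
  obtain ⟨Γ, hΓω, hΓper, hΓ0, hΓγ⟩ :=
    exists_analytic_approx_iteratedDeriv_eq hγ hper (max k₀ 3) (lt_min hε hδ)
  have hΓ : ContDiff ℝ (⊤ : ℕ∞) Γ := hΓω.of_le le_top
  have hcomp : ∀ k ∈ Set.Icc 1 4, ∀ i,
      iteratedDeriv k (fun t => Γ t i) 0 = iteratedDeriv k (fun t => γ t i) 0 := fun k hk i => by
    rw [iteratedDeriv_euclidean_apply hΓ, iteratedDeriv_euclidean_apply hγ, hΓ0 k hk]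
  have hcomp₁ := hcomp 1 (by simp)
  simp only [iteratedDeriv_one] at hcomp₁
  have hd₁ : deriv Γ 0 = deriv γ 0 := by simpa using hΓ0 1 (by simp)
  have hd₂ := hΓ0 2 (by simp)
  have hd₃ := hΓ0 3 (by simp)
  rw [iteratedDeriv_two_eq, iteratedDeriv_two_eq] at hd₂
  rw [iteratedDeriv_three_eq, iteratedDeriv_three_eq] at hd₃
  obtain ⟨hΓreg, hΓinfl⟩ := hstable Γ hΓ hΓper
    (fun t => dist_threeJet_lt fun k hk =>
      (hΓγ k (hk.trans (le_max_right _ _)) t).trans_le (min_le_right _ _))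
    (by rw [hd₁, hd₂]; exact (h1 0).2 ⟨0, by simp⟩)
  refine ⟨Γ, fun t => hΓω.contDiffAt.analyticAt, hΓper, hΓreg, hΓinfl, fun h0 => hgen ?_,
    (hcomp₁ 1).trans h2a, (hcomp 2 (by simp) 1).trans h2b, fun h => h2c ?_,
    (hcomp₁ 2).trans h3a, (hcomp 2 (by simp) 2).trans h3b, (hcomp 3 (by simp) 2).trans h3c,
    (hcomp 4 (by simp) 2).trans h3d,
    fun t k hk => (hΓγ k (hk.trans (le_max_left _ _)) t).trans_le (min_le_left _ _)⟩
  · have h := hasDerivAt_euclidean_apply (differentiable_cross3_deriv hΓ 0).hasDerivAt 2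
    rw [← hd₁, ← hd₃, ← h.unique (hasDerivAt_cross3_deriv_apply_two hΓ 0), h0]
    rfl
  · rw [← hcomp 3 (by simp) 1, h]
end
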